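/- (The critical position is the geometric one.) In the setting of Theorem 2.3 with fixed direction e ∈ ∂B₁(0), with λ₀ the largest λ at which Situation 1 or Situation 2 occurs and λ* = inf{λ ≥ λ₀ : v_μ ≥ 0 in H^μ for all μ > λ}, one has λ* = λ₀. -/

import Mathlib

open MeasureTheory Set Filter Metric Asymptotics
open scoped RealInnerProductSpace ENNReal Topology NNReal

noncomputable section

abbrev Rd (d : ℕ) := EuclideanSpace ℝ (Fin d)

/-- The data of a Bernstein function `Ψ` vanishing at `0`, its Lévy measure `𝔪`,
and the weak scaling conditions. -/
structure PsiSetting (d : ℕ) where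
  Ψ : ℝ → ℝ
  m : Measure ℝ
  m_onIoi : m (Set.Iic 0) = 0
  smooth : ContDiffOn ℝ (⊤ : ℕ∞) Ψ (Set.Ioi 0)
  nonneg : ∀ x > (0:ℝ), 0 ≤ Ψ x
  deriv_alt : ∀ n : ℕ, ∀ x > (0:ℝ),
    (-1 : ℝ) ^ (n + 1) * iteratedDerivWithin (n + 1) Ψ (Set.Ioi 0) x ≤ 0
  zero_lim : Filter.Tendsto Ψ (nhdsWithin 0 (Set.Ioi 0)) (nhds 0)
  levy_rep : ∀ lam > (0:ℝ), Ψ lam = ∫ t, (1 - Real.exp (-lam * t)) ∂m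
  a₁ : ℝ
  a₂ : ℝ
  b₁ : ℝ
  b₂ : ℝ
  ha₁ : 0 < a₁
  ha₁₂ : a₁ ≤ a₂
  ha₂ : a₂ < 1
  hb₁ : 1 ≤ b₁
  hb₂ : 1 < b₂
  scaling_lower : ∀ r R : ℝ, 1 ≤ r → r ≤ R → (1 / b₁) * (R / r) ^ a₁ ≤ Ψ R / Ψ r
  scaling_upper : ∀ r R : ℝ, 1 ≤ r → r ≤ R → Ψ R / Ψ r ≤ b₁ * (R / r) ^ a₂

/-- The jump kernel `j(r) = ∫_0^∞ (4πt)^{-d/2} e^{-r²/(4t)} 𝔪(dt)`. -/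
def PsiSetting.j {d : ℕ} (S : PsiSetting d) (r : ℝ) : ℝ :=
  ∫ t, (4 * Real.pi * t) ^ (-(d : ℝ) / 2) * Real.exp (-(r ^ 2) / (4 * t)) ∂S.m

/-- The condition `j(r) ≤ b₂ j(r+1)` for `r ≥ 1`. -/
def PsiSetting.kernelCond {d : ℕ} (S : PsiSetting d) : Prop :=
  ∀ r : ℝ, 1 ≤ r → S.j r ≤ S.b₂ * S.j (r + 1)

/-- The nonlocal operator `Ψ(−Δ)` applied to a test function. -/
def psiOp {d : ℕ} (S : PsiSetting d) (φ : Rd d → ℝ) (x : Rd d) : ℝ :=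
  ∫ z : Rd d,
    (φ x - φ (x + z) + (if ‖z‖ ≤ 1 then ⟪z, gradient φ x⟫ else 0)) * S.j ‖z‖

/-- Admissible test functions at `x`: bounded continuous and C² near `x`. -/
def TestAt {d : ℕ} (x : Rd d) (φ : Rd d → ℝ) : Prop :=
  (∃ M, ∀ y, |φ y| ≤ M) ∧ Continuous φ ∧ ∃ U ∈ nhds x, ContDiffOn ℝ 2 φ U

/-- Viscosity supersolution of `Ψ(−Δ)u + c·u = g` in `Ω`. -/
def IsSuperSol {d : ℕ} (S : PsiSetting d) (Ω : Set (Rd d)) (c g u : Rd d → ℝ) : Prop :=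
  LowerSemicontinuous u ∧
    ∀ x ∈ Ω, ∀ φ : Rd d → ℝ, TestAt x φ → φ x = u x → (∀ y, y ≠ x → φ y < u y) →
      g x ≤ psiOp S φ x + c x * u x

/-- Viscosity subsolution of `Ψ(−Δ)u + c·u = g` in `Ω`. -/
def IsSubSol {d : ℕ} (S : PsiSetting d) (Ω : Set (Rd d)) (c g u : Rd d → ℝ) : Prop :=
  UpperSemicontinuous u ∧
    ∀ x ∈ Ω, ∀ φ : Rd d → ℝ, TestAt x φ → φ x = u x → (∀ y, y ≠ x → u y < φ y) →
      psiOp S φ x + c x * u x ≤ g x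

/-- Viscosity solution of `Ψ(−Δ)u + c·u = g` in `Ω`. -/
def IsSol {d : ℕ} (S : PsiSetting d) (Ω : Set (Rd d)) (c g u : Rd d → ℝ) : Prop :=
  IsSubSol S Ω c g u ∧ IsSuperSol S Ω c g u

/-- `V` is the renewal function of the ascending ladder-height process associated with `Ψ`. -/
structure IsRenewal (Ψ V : ℝ → ℝ) : Prop where
  nonneg : ∀ x, 0 ≤ V x
  zero : ∀ x ≤ (0:ℝ), V x = 0
  cont : ContinuousOn V (Set.Ioi 0)
  mono : StrictMonoOn V (Set.Ioi 0)
  laplace : ∀ s : ℝ, 0 < s →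
    (∫ x in Set.Ioi (0 : ℝ), V x * Real.exp (-s * x)) =
      1 / (s * Real.exp ((1 / Real.pi) *
        ∫ y in Set.Ioi (0 : ℝ), Real.log (Ψ (s * y)) / (1 + y ^ 2)))

/-- `tr_V(u)(x) = t`: the `V`-trace of `u` at the boundary point `x` of `D`. -/
def HasVTrace {d : ℕ} (V : ℝ → ℝ) (D : Set (Rd d)) (u : Rd d → ℝ)
    (x : Rd d) (t : ℝ) : Prop :=
  Filter.Tendsto (fun z => u z / V (Metric.infDist z Dᶜ)) (nhdsWithin x D) (nhds t)

/-- An open set has C² boundary. -/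
def HasC2Boundary {d : ℕ} (D : Set (Rd d)) : Prop :=
  ∀ x ∈ frontier D, ∃ (U : Set (Rd d)) (f : Rd d → ℝ),
    IsOpen U ∧ x ∈ U ∧ ContDiffOn ℝ 2 f U ∧ (∀ y ∈ U, fderiv ℝ f y ≠ 0) ∧
      D ∩ U = {y ∈ U | f y < 0}

/-- A closed set has C² boundary. -/
def HasC2BoundaryClosed {d : ℕ} (G : Set (Rd d)) : Prop :=
  ∀ x ∈ frontier G, ∃ (U : Set (Rd d)) (f : Rd d → ℝ),
    IsOpen U ∧ x ∈ U ∧ ContDiffOn ℝ 2 f U ∧ (∀ y ∈ U, fderiv ℝ f y ≠ 0) ∧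
      G ∩ U = {y ∈ U | f y ≤ 0}

/-- Reflection `R_{λ,e}` across the hyperplane `{x·e = λ}`. -/
def reflAt {d : ℕ} (e : Rd d) (lam : ℝ) (x : Rd d) : Rd d :=
  x - (2 * ⟪x, e⟫ - 2 * lam) • e

/-- The open half-space `H_{λ,e} = {x·e > λ}`. -/
def halfSpace {d : ℕ} (e : Rd d) (lam : ℝ) : Set (Rd d) := {x | lam < ⟪x, e⟫}

/-- A function is antisymmetric with respect to the half-space `H_{λ,e}`. -/
def AntiSym {d : ℕ} (e : Rd d) (lam : ℝ) (u : Rd d → ℝ) : Prop :=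
  ∀ x, u x = - u (reflAt e lam x)

/-- The hyperplane `{x·e = λ}` is orthogonal to `∂G` at `p` (expressed through
a local C² defining function of `G` near `p`). -/
def OrthAt {d : ℕ} (G : Set (Rd d)) (e p : Rd d) : Prop :=
  ∃ (U : Set (Rd d)) (f : Rd d → ℝ), IsOpen U ∧ p ∈ U ∧ ContDiffOn ℝ 2 f U ∧
    fderiv ℝ f p ≠ 0 ∧ G ∩ U = {y ∈ U | f y ≤ 0} ∧ fderiv ℝ f p e = 0

/-- Situation 1: a touching point `p₀ ∈ ∂G ∩ ∂R_{λ,e}(G ∩ H_{λ,e})` away from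
the hyperplane `{x·e = λ}`. -/
def Sit1 {d : ℕ} (G : Set (Rd d)) (e : Rd d) (lam : ℝ) : Prop :=
  ∃ p, p ∈ frontier G ∧
    p ∈ frontier (reflAt e lam '' (G ∩ halfSpace e lam)) ∧ ⟪p, e⟫ ≠ lam

/-- Situation 2: the hyperplane `{x·e = λ}` is orthogonal to `∂G` at some
point `p₀ ∈ ∂G ∩ {x·e = λ}`. -/
def Sit2 {d : ℕ} (G : Set (Rd d)) (e : Rd d) (lam : ℝ) : Prop :=
  ∃ p, p ∈ frontier G ∧ ⟪p, e⟫ = lam ∧ OrthAt G e p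

/-- The Gauss-Weierstrass kernel `(4 π t)^(-d/2) exp(-r² / (4 t))`. -/
def heatKernel (d : ℕ) (r t : ℝ) : ℝ :=
  (4 * Real.pi * t) ^ (-(d : ℝ) / 2) * Real.exp (-(r ^ 2) / (4 * t))

lemma heatKernel_pos (d : ℕ) (r : ℝ) {t : ℝ} (ht : 0 < t) : 0 < heatKernel d r t := by
  unfold heatKernel
  have := Real.pi_pos
  positivity

lemma heatKernel_strictAnti (d : ℕ) {t : ℝ} (ht : 0 < t) :
    StrictAntiOn (fun r => heatKernel d r t) (Set.Ici 0) := by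
  intro r hr s _ hrs
  have hr0 : (0 : ℝ) ≤ r := hr
  have := Real.pi_pos
  unfold heatKernel
  refine mul_lt_mul_of_pos_left (Real.exp_lt_exp.2 ?_) (by positivity)
  rw [div_lt_div_iff_of_pos_right (by positivity)]
  nlinarith

lemma measurable_heatKernel (d : ℕ) : Measurable (fun p : ℝ × ℝ => heatKernel d p.1 p.2) := by
  unfold heatKernel
  fun_prop

lemma lintegral_gaussian (d : ℕ) {b : ℝ} (hb : 0 < b) :
    ∫⁻ z : Rd d, ENNReal.ofReal (Real.exp (-b * ‖z‖ ^ 2)) =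
      ENNReal.ofReal ((Real.pi / b) ^ ((d : ℝ) / 2)) := by
  have h := GaussianFourier.integral_rexp_neg_mul_sq_norm (V := Rd d) hb
  rw [finrank_euclideanSpace_fin] at h
  have hpos : 0 < (Real.pi / b) ^ ((d : ℝ) / 2) := by
    have := Real.pi_pos
    positivity
  have hInt : Integrable (fun z : Rd d => Real.exp (-b * ‖z‖ ^ 2)) := by
    by_contra hcon
    rw [integral_undef hcon] at h
    exact hpos.ne h
  rw [← h, ofReal_integral_eq_lintegral_ofReal hInt (ae_of_all _ fun z => (Real.exp_pos _).le)]

lemma lintegral_heatKernel (d : ℕ) {t : ℝ} (ht : 0 < t) :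
    ∫⁻ z : Rd d, ENNReal.ofReal (heatKernel d ‖z‖ t) = 1 := by
  have hπ := Real.pi_pos
  have h := lintegral_gaussian d (b := 1 / (4 * t)) (by positivity)
  have hc : 0 ≤ (4 * Real.pi * t) ^ (-(d : ℝ) / 2) := by positivity
  unfold heatKernel
  simp_rw [ENNReal.ofReal_mul hc]
  rw [lintegral_const_mul _ (by fun_prop)]
  have h' : ∀ z : Rd d, -(‖z‖ ^ 2) / (4 * t) = -(1 / (4 * t)) * ‖z‖ ^ 2 := fun z => by ring
  simp_rw [h']
  rw [h, ← ENNReal.ofReal_mul hc, show Real.pi / (1 / (4 * t)) = 4 * Real.pi * t by field_simp,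
    ← Real.rpow_add (by positivity)]
  simp [neg_div]

lemma lintegral_sq_mul_heatKernel_le (d : ℕ) {t : ℝ} (ht : 0 < t) :
    ∫⁻ z : Rd d, ENNReal.ofReal (‖z‖ ^ 2 * heatKernel d ‖z‖ t) ≤
      ENNReal.ofReal (8 * 2 ^ ((d : ℝ) / 2) * t) := by
  have hπ := Real.pi_pos
  have h := lintegral_gaussian d (b := 1 / (8 * t)) (by positivity)
  have hc : 0 ≤ 8 * t * (4 * Real.pi * t) ^ (-(d : ℝ) / 2) := by positivity
  calc
    _ ≤ ∫⁻ z : Rd d, ENNReal.ofReal (8 * t * (4 * Real.pi * t) ^ (-(d : ℝ) / 2)) *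
          ENNReal.ofReal (Real.exp (-(1 / (8 * t)) * ‖z‖ ^ 2)) := by
        refine lintegral_mono fun z => ?_
        rw [← ENNReal.ofReal_mul hc]
        refine ENNReal.ofReal_le_ofReal ?_
        have e1 : -(‖z‖ ^ 2) / (4 * t) = -(1 / (8 * t)) * ‖z‖ ^ 2 + -(‖z‖ ^ 2 / (8 * t)) := by
          field_simp
          ring
        have e2 : ‖z‖ ^ 2 / (8 * t) * Real.exp (-(‖z‖ ^ 2 / (8 * t))) ≤ 1 := by
          have h1 := Real.add_one_le_exp (‖z‖ ^ 2 / (8 * t))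
          rw [Real.exp_neg, ← div_eq_mul_inv, div_le_one (Real.exp_pos _)]
          linarith
        unfold heatKernel
        rw [e1, Real.exp_add]
        have e3 : ‖z‖ ^ 2 * ((4 * Real.pi * t) ^ (-(d : ℝ) / 2) *
            (Real.exp (-(1 / (8 * t)) * ‖z‖ ^ 2) * Real.exp (-(‖z‖ ^ 2 / (8 * t))))) =
            (8 * t * (4 * Real.pi * t) ^ (-(d : ℝ) / 2) * Real.exp (-(1 / (8 * t)) * ‖z‖ ^ 2)) *
              (‖z‖ ^ 2 / (8 * t) * Real.exp (-(‖z‖ ^ 2 / (8 * t)))) := by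
          field_simp
        rw [e3]
        exact mul_le_of_le_one_right (by positivity) e2
    _ = ENNReal.ofReal (8 * 2 ^ ((d : ℝ) / 2) * t) := by
        rw [lintegral_const_mul _ (by fun_prop), h, ← ENNReal.ofReal_mul hc]
        congr 1
        rw [show Real.pi / (1 / (8 * t)) = 2 * (4 * Real.pi * t) by field_simp; ring,
          Real.mul_rpow (x := 2) (y := 4 * Real.pi * t) (by norm_num) (by positivity)]
        have e4 : (4 * Real.pi * t) ^ (-(d : ℝ) / 2) * (4 * Real.pi * t) ^ ((d : ℝ) / 2) = 1 := by
          rw [← Real.rpow_add (by positivity)]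
          simp [neg_div]
        linear_combination (8 * t * 2 ^ ((d : ℝ) / 2)) * e4

namespace PsiSetting

variable {d : ℕ} (S : PsiSetting d)

lemma Psi_pos {r : ℝ} (hr : 1 ≤ r) : 0 < S.Ψ r := by
  have h := S.scaling_lower r r hr le_rfl
  have hr0 : 0 < r := by linarith
  have hb : 0 < S.b₁ := by linarith [S.hb₁]
  refine lt_of_le_of_ne (S.nonneg r hr0) fun h0 => ?_
  rw [← h0, div_zero, div_self hr0.ne', Real.one_rpow] at h
  have : 0 < 1 / S.b₁ * 1 := by positivity
  linarith

lemma ae_pos : ∀ᵐ t ∂S.m, 0 < t := by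
  rw [ae_iff]
  have : {t : ℝ | ¬ 0 < t} = Set.Iic 0 := by
    ext t
    simp
  rw [this]
  exact S.m_onIoi

lemma integrable_one_sub_exp {l : ℝ} (hl : 1 ≤ l) :
    Integrable (fun t => 1 - Real.exp (-l * t)) S.m := by
  by_contra hcon
  have h := S.levy_rep l (by linarith)
  rw [integral_undef hcon] at h
  exact (S.Psi_pos hl).ne' h

instance sigmaFinite_m : SigmaFinite S.m := by
  have hInt := S.integrable_one_sub_exp le_rfl
  refine Measure.sigmaFinite_of_countable
    (S := insert (Set.Iic 0) (Set.range fun n : ℕ => {t : ℝ | 1 / ((n : ℝ) + 1) ≤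
      1 - Real.exp (-1 * t)})) ((countable_range _).insert _) ?_ ?_
  · rintro s (rfl | ⟨n, rfl⟩)
    · rw [S.m_onIoi]
      simp
    · exact hInt.measure_ge_lt_top (by positivity)
  · refine eq_univ_of_forall fun t => ?_
    rcases le_or_gt t 0 with h | h
    · exact ⟨_, Set.mem_insert _ _, h⟩
    · have : 0 < 1 - Real.exp (-1 * t) := by
        have : Real.exp (-1 * t) < 1 := Real.exp_lt_one_iff.2 (by linarith)
        linarith
      obtain ⟨n, hn⟩ := exists_nat_one_div_lt this
      exact ⟨_, Set.mem_insert_of_mem _ ⟨n, rfl⟩, hn.le⟩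

lemma m_univ : S.m Set.univ = ∞ := by
  by_contra hcon
  have hb : 0 < S.b₁ := by linarith [S.hb₁]
  have : IsFiniteMeasure S.m := ⟨lt_top_iff_ne_top.2 hcon⟩
  have hbd : ∀ R : ℝ, 1 ≤ R → S.Ψ R ≤ (S.m Set.univ).toReal := by
    intro R hR
    rw [S.levy_rep R (by linarith)]
    calc
      _ ≤ ∫ _, (1 : ℝ) ∂S.m := by
        refine integral_mono_ae (S.integrable_one_sub_exp hR) (integrable_const _)
          (ae_of_all _ fun t => ?_)
        have := Real.exp_pos (-R * t)
        simp only
        linarith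
      _ = _ := by simp [Measure.real]
  have h1 := S.Psi_pos le_rfl
  have ht : Tendsto (fun R : ℝ => 1 / S.b₁ * R ^ S.a₁ * S.Ψ 1) atTop atTop :=
    ((tendsto_rpow_atTop S.ha₁).const_mul_atTop (by positivity)).atTop_mul_const h1
  obtain ⟨R, hR, hR1⟩ := ((ht.eventually_gt_atTop (S.m Set.univ).toReal).and
    (eventually_ge_atTop 1)).exists
  have h2 := S.scaling_lower 1 R le_rfl hR1
  rw [div_one, le_div_iff₀ h1] at h2
  linarith [hbd R hR1]

/-- The jump kernel with values in `[0, ∞]`. -/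
def jE (r : ℝ) : ℝ≥0∞ := ∫⁻ t, ENNReal.ofReal (heatKernel d r t) ∂S.m

lemma measurable_jE : Measurable S.jE :=
  Measurable.lintegral_prod_right' (f := fun p : ℝ × ℝ => ENNReal.ofReal (heatKernel d p.1 p.2))
    (measurable_heatKernel d).ennreal_ofReal

lemma j_eq_toReal (r : ℝ) : S.j r = (S.jE r).toReal := by
  unfold j jE
  refine integral_eq_lintegral_of_nonneg_ae ?_ ?_
  · filter_upwards [S.ae_pos] with t ht using (heatKernel_pos d r ht).le
  · exact ((measurable_heatKernel d).comp (measurable_const.prodMk measurable_id)).aestronglyMeasurable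

lemma j_nonneg (r : ℝ) : 0 ≤ S.j r := by
  rw [j_eq_toReal]
  exact ENNReal.toReal_nonneg

lemma measurable_j : Measurable S.j := by
  have : S.j = fun r => (S.jE r).toReal := funext S.j_eq_toReal
  rw [this]
  exact S.measurable_jE.ennreal_toReal

lemma jE_anti : AntitoneOn S.jE (Set.Ici 0) := by
  intro r hr s hs hrs
  refine lintegral_mono_ae ?_
  filter_upwards [S.ae_pos] with t ht
  exact ENNReal.ofReal_le_ofReal ((heatKernel_strictAnti d ht).antitoneOn hr hs hrs)

lemma lintegral_lintegral_heatKernel {w : Rd d → ℝ≥0∞} (hw : Measurable w) :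
    ∫⁻ z, w z * S.jE ‖z‖ = ∫⁻ t, (∫⁻ z : Rd d, w z * ENNReal.ofReal (heatKernel d ‖z‖ t)) ∂S.m := by
  have hm : Measurable fun p : Rd d × ℝ => ENNReal.ofReal (heatKernel d ‖p.1‖ p.2) :=
    ((measurable_heatKernel d).comp
      ((measurable_norm.comp measurable_fst).prodMk measurable_snd)).ennreal_ofReal
  have h := lintegral_lintegral_swap (μ := (volume : Measure (Rd d))) (ν := S.m)
    (f := fun z t => w z * ENNReal.ofReal (heatKernel d ‖z‖ t))
    ((hw.comp measurable_fst).mul hm).aemeasurable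
  rw [← h]
  refine lintegral_congr fun z => ?_
  exact (lintegral_const_mul (w z) (hm.comp (measurable_prodMk_left (x := z)))).symm

lemma lintegral_jE : ∫⁻ z : Rd d, S.jE ‖z‖ = ∞ := by
  have h := S.lintegral_lintegral_heatKernel (w := fun _ => 1) measurable_const
  simp only [one_mul] at h
  rw [h, ← S.m_univ, ← lintegral_one]
  refine lintegral_congr_ae ?_
  filter_upwards [S.ae_pos] with t ht using lintegral_heatKernel d ht

lemma lintegral_min_mul_jE_lt_top :
    ∫⁻ z : Rd d, ENNReal.ofReal (min 1 (‖z‖ ^ 2)) * S.jE ‖z‖ < ∞ := by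
  rw [S.lintegral_lintegral_heatKernel (by fun_prop)]
  set C : ℝ := 8 * 2 ^ ((d : ℝ) / 2) with hC
  have hC0 : 1 ≤ C := by
    have : (1 : ℝ) ≤ 2 ^ ((d : ℝ) / 2) := Real.one_le_rpow (by norm_num) (by positivity)
    linarith
  calc
    _ ≤ ∫⁻ t, ENNReal.ofReal (2 * C * (1 - Real.exp (-1 * t))) ∂S.m := by
      refine lintegral_mono_ae ?_
      filter_upwards [S.ae_pos] with t ht
      have h1 : ∫⁻ z : Rd d, ENNReal.ofReal (min 1 (‖z‖ ^ 2)) *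
          ENNReal.ofReal (heatKernel d ‖z‖ t) ≤ 1 := by
        rw [← lintegral_heatKernel d ht]
        refine lintegral_mono fun z => mul_le_of_le_one_left' ?_
        exact ENNReal.ofReal_le_one.2 (min_le_left _ _)
      have h2 : ∫⁻ z : Rd d, ENNReal.ofReal (min 1 (‖z‖ ^ 2)) *
          ENNReal.ofReal (heatKernel d ‖z‖ t) ≤ ENNReal.ofReal (C * t) := by
        refine le_trans (lintegral_mono fun z => ?_) (lintegral_sq_mul_heatKernel_le d ht)
        simp only
        rw [ENNReal.ofReal_mul (by positivity)]
        gcongr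
        exact min_le_right _ _
      have h3 : t / (1 + t) ≤ 1 - Real.exp (-1 * t) := by
        have := Real.add_one_le_exp t
        rw [neg_one_mul, Real.exp_neg]
        have h4 : (Real.exp t)⁻¹ ≤ (1 + t)⁻¹ := inv_anti₀ (by linarith) (by linarith)
        have h5 : t / (1 + t) = 1 - (1 + t)⁻¹ := by field_simp; ring
        linarith
      rcases le_or_gt t 1 with h | h
      · refine h2.trans (ENNReal.ofReal_le_ofReal ?_)
        have : t / 2 ≤ t / (1 + t) := by gcongr; linarith
        nlinarith
      · refine h1.trans ?_
        rw [ENNReal.one_le_ofReal]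
        have : 1 / 2 ≤ t / (1 + t) := by
          rw [div_le_div_iff₀ (by norm_num) (by linarith)]
          linarith
        nlinarith
    _ < ∞ := ((S.integrable_one_sub_exp le_rfl).const_mul (2 * C)).lintegral_lt_top

lemma jE_lt_top (hd : 0 < d) {r : ℝ} (hr : 0 < r) : S.jE r < ∞ := by
  have hae : ∀ᵐ z : Rd d, ENNReal.ofReal (min 1 (‖z‖ ^ 2)) * S.jE ‖z‖ < ∞ :=
    ae_lt_top ((by fun_prop : Measurable fun z : Rd d => ENNReal.ofReal (min 1 (‖z‖ ^ 2))).mul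
      (S.measurable_jE.comp measurable_norm)) S.lintegral_min_mul_jE_lt_top.ne
  have : Nonempty (Fin d) := ⟨⟨0, hd⟩⟩
  have hae0 : ∀ᵐ z : Rd d, z ≠ 0 := by
    rw [ae_iff]
    simp
  have hball : ∃ᵐ z : Rd d, z ∈ ball (0 : Rd d) r := by
    intro h
    refine (measure_ball_pos volume (0 : Rd d) hr).ne' ?_
    rw [ae_iff] at h
    simpa only [not_not, Set.ofPred_mem_eq] using h
  obtain ⟨z, hzr, hz0, hz⟩ := (hball.and_eventually (hae0.and hae)).exists
  have hz0' : 0 < ‖z‖ := norm_pos_iff.2 hz0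
  have hfin : S.jE ‖z‖ < ∞ := by
    by_contra hcon
    rw [not_lt, top_le_iff] at hcon
    rw [hcon, ENNReal.mul_top] at hz
    · exact lt_irrefl _ hz
    · have : 0 < min 1 (‖z‖ ^ 2) := by positivity
      exact (ENNReal.ofReal_pos.2 this).ne'
  refine (S.jE_anti hz0'.le hr.le ?_).trans_lt hfin
  simpa using (mem_ball_zero_iff.1 hzr).le

lemma integrable_heatKernel (hd : 0 < d) {r : ℝ} (hr : 0 < r) :
    Integrable (fun t => heatKernel d r t) S.m := by
  refine ⟨((measurable_heatKernel d).comp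
    (measurable_const.prodMk measurable_id)).aestronglyMeasurable, ?_⟩
  rw [hasFiniteIntegral_iff_ofReal]
  · exact S.jE_lt_top hd hr
  · filter_upwards [S.ae_pos] with t ht using (heatKernel_pos d r ht).le

lemma j_strictAnti (hd : 0 < d) : StrictAntiOn S.j (Set.Ioi 0) := by
  intro r hr s hs hrs
  have hr0 : 0 < r := hr
  have hs0 : 0 < s := hs
  have hi : Integrable (fun t => heatKernel d r t - heatKernel d s t) S.m :=
    (S.integrable_heatKernel hd hr).sub (S.integrable_heatKernel hd hs)
  have hpos : ∀ t, 0 < t → 0 < heatKernel d r t - heatKernel d s t := fun t ht =>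
    sub_pos.2 (heatKernel_strictAnti d ht hr0.le hs0.le hrs)
  have h : 0 < ∫ t, (heatKernel d r t - heatKernel d s t) ∂S.m := by
    refine (integral_pos_iff_support_of_nonneg_ae ?_ hi).2 ?_
    · filter_upwards [S.ae_pos] with t ht using (hpos t ht).le
    · have : S.m (Function.support fun t => heatKernel d r t - heatKernel d s t) =
          S.m Set.univ := by
        refine measure_congr ?_
        filter_upwards [S.ae_pos] with t ht
        exact eq_true (hpos t ht).ne' |>.trans (eq_true trivial).symm
      rw [this, S.m_univ]
      simp
  rw [integral_sub (S.integrable_heatKernel hd hr) (S.integrable_heatKernel hd hs)] at h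
  exact sub_pos.1 h

lemma j_pos (hd : 0 < d) {r : ℝ} (hr : 0 < r) : 0 < S.j r :=
  (S.j_nonneg (r + 1)).trans_lt
    (S.j_strictAnti hd hr (by simp only [Set.mem_Ioi]; linarith) (by linarith))

lemma integrable_min_mul_j : Integrable (fun z : Rd d => min 1 (‖z‖ ^ 2) * S.j ‖z‖) := by
  have hm : Measurable (fun z : Rd d => min 1 (‖z‖ ^ 2) * S.j ‖z‖) :=
    (by fun_prop : Measurable fun z : Rd d => min 1 (‖z‖ ^ 2)).mul
      (S.measurable_j.comp measurable_norm)
  refine ⟨hm.aestronglyMeasurable, ?_⟩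
  rw [hasFiniteIntegral_iff_ofReal
    (ae_of_all _ fun z => mul_nonneg (by positivity) (S.j_nonneg _))]
  refine lt_of_le_of_lt (lintegral_mono fun z => ?_) S.lintegral_min_mul_jE_lt_top
  rw [ENNReal.ofReal_mul (by positivity), j_eq_toReal]
  gcongr
  exact ENNReal.ofReal_toReal_le

end PsiSetting

namespace PsiSetting

variable {d : ℕ} (S : PsiSetting d)

lemma j_le_min_mul_j {η : ℝ} (hη : 0 < η) (hη1 : η ≤ 1) {z : Rd d} (hz : η < ‖z‖) :
    S.j ‖z‖ ≤ (η ^ 2)⁻¹ * (min 1 (‖z‖ ^ 2) * S.j ‖z‖) := by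
  rw [← mul_assoc]
  refine le_mul_of_one_le_left (S.j_nonneg _) ?_
  rw [← div_eq_inv_mul, one_le_div (by positivity)]
  refine le_min ?_ ?_ <;> nlinarith

lemma integrableOn_j {η : ℝ} (hη : 0 < η) :
    IntegrableOn (fun z : Rd d => S.j ‖z‖) {z | η < ‖z‖} := by
  have hη' : 0 < min η 1 := lt_min hη one_pos
  refine Integrable.mono' ((S.integrable_min_mul_j.const_mul ((min η 1) ^ 2)⁻¹).integrableOn)
    (S.measurable_j.comp measurable_norm).aestronglyMeasurable ?_
  refine (ae_restrict_iff' (measurableSet_lt measurable_const measurable_norm)).2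
    (ae_of_all _ fun z hz => ?_)
  rw [Real.norm_of_nonneg (S.j_nonneg _)]
  exact S.j_le_min_mul_j hη' (min_le_right _ _) ((min_le_left _ _).trans_lt hz)

lemma lt_norm_of_lt_inner {e z : Rd d} (he : ‖e‖ = 1) {ρ : ℝ} (h : ρ < ⟪z, e⟫) : ρ < ‖z‖ := by
  have := real_inner_le_norm z e
  rw [he, mul_one] at this
  linarith

lemma measurableSet_halfSpace (e : Rd d) (ρ : ℝ) : MeasurableSet {z : Rd d | ρ < ⟪z, e⟫} :=
  measurableSet_lt measurable_const (by fun_prop)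

/-- The mass of the jump measure in the half-space at distance `ρ`. -/
def tailMass (e : Rd d) (ρ : ℝ) : ℝ := ∫ z in {z : Rd d | ρ < ⟪z, e⟫}, S.j ‖z‖

lemma integrableOn_j_halfSpace {e : Rd d} (he : ‖e‖ = 1) {ρ : ℝ} (hρ : 0 < ρ) :
    IntegrableOn (fun z : Rd d => S.j ‖z‖) {z | ρ < ⟪z, e⟫} :=
  (S.integrableOn_j hρ).mono_set fun _ hz => lt_norm_of_lt_inner he hz

lemma setLIntegral_jE_halfSpace {e : Rd d} (he : ‖e‖ = 1) :
    ∫⁻ z in {z : Rd d | 0 < ⟪z, e⟫}, S.jE ‖z‖ = ∞ := by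
  by_contra hcon
  have hneg : ∫⁻ z in {z : Rd d | ⟪z, e⟫ < 0}, S.jE ‖z‖ =
      ∫⁻ z in {z : Rd d | 0 < ⟪z, e⟫}, S.jE ‖z‖ := by
    have h := (LinearIsometryEquiv.neg ℝ (E := Rd d)).measurePreserving.setLIntegral_comp_preimage
      (measurableSet_halfSpace e 0) (S.measurable_jE.comp measurable_norm)
    simpa using h
  have hzero : volume {z : Rd d | ⟪z, e⟫ = 0} = 0 := by
    have h := Measure.addHaar_submodule (volume : Measure (Rd d)) (LinearMap.ker (innerₛₗ ℝ e)) ?_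
    · convert h using 2
      ext z
      simp [real_inner_comm]
    · intro htop
      have : e ∈ LinearMap.ker (innerₛₗ ℝ e) := by rw [htop]; trivial
      simp [he] at this
  have htot := S.lintegral_jE
  have hle : ∫⁻ z : Rd d, S.jE ‖z‖ ≤ ∫⁻ z in {z : Rd d | ⟪z, e⟫ < 0} ∪
      ({z : Rd d | 0 < ⟪z, e⟫} ∪ {z : Rd d | ⟪z, e⟫ = 0}), S.jE ‖z‖ := by
    rw [← setLIntegral_univ]
    refine lintegral_mono_set fun z _ => ?_
    rcases lt_trichotomy (⟪z, e⟫ : ℝ) 0 with h | h | h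
    · exact Or.inl h
    · exact Or.inr (Or.inr h)
    · exact Or.inr (Or.inl h)
  have h2 := hle.trans ((lintegral_union_le _ _ _).trans
    (add_le_add le_rfl (lintegral_union_le _ _ _)))
  rw [htot, setLIntegral_measure_zero _ _ hzero, hneg, add_zero, top_le_iff,
    ENNReal.add_eq_top] at h2
  exact hcon (h2.elim id id)

lemma eventually_lt_tailMass (hd : 0 < d) {e : Rd d} (he : ‖e‖ = 1) (C : ℝ) :
    ∀ᶠ ρ in 𝓝[>] (0 : ℝ), C < S.tailMass e ρ := by
  have hU : {z : Rd d | 0 < ⟪z, e⟫} = ⋃ n : ℕ, {z : Rd d | 1 / ((n : ℝ) + 1) < ⟪z, e⟫} := by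
    ext z
    simp only [Set.mem_ofPred_eq, Set.mem_iUnion]
    exact ⟨fun h => exists_nat_one_div_lt h, fun ⟨n, hn⟩ => lt_trans (by positivity) hn⟩
  have hmono : Monotone fun n : ℕ => {z : Rd d | 1 / ((n : ℝ) + 1) < ⟪z, e⟫} :=
    fun n k hnk z (hz : _ < _) => (Nat.one_div_le_one_div (α := ℝ) hnk).trans_lt hz
  have ht := tendsto_measure_iUnion_atTop (μ := volume.withDensity fun z : Rd d => S.jE ‖z‖) hmono
  rw [← hU, withDensity_apply _ (measurableSet_halfSpace e 0), S.setLIntegral_jE_halfSpace he] at ht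
  obtain ⟨n, hn⟩ := (ht.eventually (lt_mem_nhds (ENNReal.ofReal_lt_top (r := C)))).exists
  rw [Function.comp_apply, withDensity_apply _ (measurableSet_halfSpace e _)] at hn
  have hn0 : 0 < 1 / ((n : ℝ) + 1) := by positivity
  have hfin : ∀ ρ, 0 < ρ → ENNReal.ofReal (S.tailMass e ρ) =
      ∫⁻ z in {z : Rd d | ρ < ⟪z, e⟫}, S.jE ‖z‖ := by
    intro ρ hρ
    rw [tailMass, ofReal_integral_eq_lintegral_ofReal (S.integrableOn_j_halfSpace he hρ)
      (ae_of_all _ fun z => S.j_nonneg _)]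
    refine setLIntegral_congr_fun (measurableSet_halfSpace e ρ) fun z hz => ?_
    rw [j_eq_toReal, ENNReal.ofReal_toReal]
    exact (S.jE_lt_top hd (hρ.trans (lt_norm_of_lt_inner he hz))).ne
  filter_upwards [Ioc_mem_nhdsGT hn0] with ρ hρ
  have h1 : ENNReal.ofReal C < ENNReal.ofReal (S.tailMass e ρ) := by
    rw [hfin ρ hρ.1]
    exact hn.trans_le (lintegral_mono_set fun z hz => lt_of_le_of_lt hρ.2 hz)
  exact (ENNReal.ofReal_lt_ofReal_iff'.1 h1).1

lemma tailMass_pos (hd : 0 < d) {e : Rd d} (he : ‖e‖ = 1) {ρ : ℝ} (hρ : 0 < ρ) :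
    0 < S.tailMass e ρ := by
  refine (setIntegral_pos_iff_support_of_nonneg_ae (ae_of_all _ fun z => S.j_nonneg _)
    (S.integrableOn_j_halfSpace he hρ)).2 ?_
  have hopen : IsOpen {z : Rd d | ρ < ⟪z, e⟫} := isOpen_lt continuous_const (by fun_prop)
  refine (hopen.measure_pos volume ⟨(ρ + 1) • e, ?_⟩).trans_le (measure_mono fun z hz => ⟨?_, hz⟩)
  · simp [real_inner_smul_left, he]
  · exact (S.j_pos hd (hρ.trans (lt_norm_of_lt_inner he hz))).ne'

end PsiSetting

namespace PsiSetting

variable {d : ℕ} (S : PsiSetting d)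

/-- The truncated second moment of the jump measure over the ball of radius `δ`. -/
def smallMass (δ : ℝ) : ℝ := ∫ z in {z : Rd d | ‖z‖ ≤ δ}, min 1 (‖z‖ ^ 2) * S.j ‖z‖

lemma measurableSet_norm_le (δ : ℝ) : MeasurableSet {z : Rd d | ‖z‖ ≤ δ} :=
  measurableSet_le measurable_norm measurable_const

lemma measurableSet_lt_norm (δ : ℝ) : MeasurableSet {z : Rd d | δ < ‖z‖} :=
  measurableSet_lt measurable_const measurable_norm

lemma measurable_j_norm : Measurable fun z : Rd d => S.j ‖z‖ :=
  S.measurable_j.comp measurable_norm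

lemma integrableOn_bdd_mul_j {s : Set (Rd d)} (hs : IntegrableOn (fun z : Rd d => S.j ‖z‖) s)
    (hsm : MeasurableSet s) {F : Rd d → ℝ} (hF : Measurable F) {C : ℝ} (hC : ∀ z ∈ s, |F z| ≤ C) :
    IntegrableOn (fun z : Rd d => F z * S.j ‖z‖) s := by
  refine Integrable.mono' (hs.const_mul C) (hF.mul S.measurable_j_norm).aestronglyMeasurable ?_
  refine (ae_restrict_iff' hsm).2 (ae_of_all _ fun z hz => ?_)
  rw [norm_mul, Real.norm_of_nonneg (S.j_nonneg _)]
  exact mul_le_mul_of_nonneg_right (hC z hz) (S.j_nonneg _)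

end PsiSetting

/-- The first-order compensator in the definition of `Ψ(−Δ)`. -/
def drift {d : ℕ} (b z : Rd d) : ℝ := if ‖z‖ ≤ 1 then ⟪z, b⟫ else 0

section Drift

variable {d : ℕ}

lemma measurable_drift (b : Rd d) : Measurable (drift b) :=
  Measurable.ite (PsiSetting.measurableSet_norm_le 1) (by fun_prop) measurable_const

lemma abs_drift_le (b z : Rd d) : |drift b z| ≤ ‖b‖ := by
  unfold drift
  split_ifs with h
  · refine (abs_real_inner_le_norm z b).trans ?_
    exact mul_le_of_le_one_left (norm_nonneg _) h
  · simp

lemma drift_sub (b b' z : Rd d) : drift (b - b') z = drift b z - drift b' z := by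
  unfold drift
  split_ifs
  · rw [inner_sub_right]
  · simp

end Drift

/-- A continuous cutoff equal to `1` on the ball of radius `δ/2` and to `0` off the ball of
radius `δ`. -/
def radialCutoff {d : ℕ} (δ : ℝ) (z : Rd d) : ℝ := max 0 (min 1 (2 - 2 * ‖z‖ / δ))

section Cutoff

variable {d : ℕ} {δ : ℝ}

lemma continuous_radialCutoff : Continuous (radialCutoff (d := d) δ) := by
  unfold radialCutoff
  fun_prop

lemma radialCutoff_nonneg (z : Rd d) : 0 ≤ radialCutoff δ z := le_max_left _ _

lemma radialCutoff_le_one (z : Rd d) : radialCutoff δ z ≤ 1 := max_le zero_le_one (min_le_left _ _)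

lemma radialCutoff_eq_one (hδ : 0 < δ) {z : Rd d} (hz : ‖z‖ ≤ δ / 2) : radialCutoff δ z = 1 := by
  unfold radialCutoff
  have : 2 * ‖z‖ / δ ≤ 1 := by
    rw [div_le_one hδ]
    linarith
  rw [min_eq_left (by linarith), max_eq_right zero_le_one]

lemma radialCutoff_eq_zero (hδ : 0 < δ) {z : Rd d} (hz : δ ≤ ‖z‖) : radialCutoff δ z = 0 := by
  unfold radialCutoff
  have : 2 ≤ 2 * ‖z‖ / δ := by
    rw [le_div_iff₀ hδ]
    linarith
  exact max_eq_left ((min_le_right _ _).trans (by linarith))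

end Cutoff

/-- The test function obtained by gluing a paraboloid near `x` to a slight lowering of `u`. -/
def gluedTest {d : ℕ} (u : Rd d → ℝ) (x b : Rd d) (M θ δ : ℝ) (y : Rd d) : ℝ :=
  radialCutoff δ (y - x) * (u x + ⟪y - x, b⟫ - (M + θ) * ‖y - x‖ ^ 2) +
    (1 - radialCutoff δ (y - x)) * (u y - θ * min 1 (‖y - x‖ ^ 2))

section GluedTest

variable {d : ℕ} {u : Rd d → ℝ} {x b : Rd d} {M θ δ B : ℝ}

lemma continuous_gluedTest (hu : Continuous u) : Continuous (gluedTest u x b M θ δ) := by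
  have := continuous_radialCutoff (d := d) (δ := δ)
  unfold gluedTest
  fun_prop

lemma gluedTest_self (hδ : 0 < δ) : gluedTest u x b M θ δ x = u x := by
  unfold gluedTest
  rw [radialCutoff_eq_one hδ (by simpa using (half_pos hδ).le)]
  simp

lemma gluedTest_eventuallyEq (hδ : 0 < δ) :
    gluedTest u x b M θ δ =ᶠ[𝓝 x] fun y => u x + ⟪y - x, b⟫ - (M + θ) * ‖y - x‖ ^ 2 := by
  filter_upwards [closedBall_mem_nhds x (half_pos hδ)] with y hy
  rw [mem_closedBall, dist_eq_norm] at hy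
  unfold gluedTest
  rw [radialCutoff_eq_one hδ hy]
  ring

lemma gradient_gluedTest (hδ : 0 < δ) : gradient (gluedTest u x b M θ δ) x = b := by
  refine HasGradientAt.gradient ?_
  rw [hasGradientAt_iff_hasFDerivAt]
  refine HasFDerivAt.congr_of_eventuallyEq ?_ (gluedTest_eventuallyEq hδ)
  have h1 : HasFDerivAt (fun y : Rd d => y - x) (ContinuousLinearMap.id ℝ (Rd d)) x :=
    (hasFDerivAt_id x).sub_const x
  have h2 := ((h1.inner ℝ (hasFDerivAt_const b x)).const_add (u x)).sub
    ((h1.norm_sq).const_mul (M + θ))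
  refine HasFDerivAt.congr_fderiv h2 ?_
  ext z
  simp [real_inner_comm]

lemma abs_gluedTest_le (hδ : 0 < δ) (hδ1 : δ ≤ 1) (hM : 0 ≤ M) (hθ : 0 ≤ θ)
    (hB : ∀ y, |u y| ≤ B) (y : Rd d) :
    |gluedTest u x b M θ δ y| ≤ (B + ‖b‖ + (M + θ)) + (B + θ) := by
  have hB0 : 0 ≤ B := (abs_nonneg _).trans (hB x)
  have hc0 := radialCutoff_nonneg (δ := δ) (y - x)
  have hc1 := radialCutoff_le_one (δ := δ) (y - x)
  unfold gluedTest
  refine (abs_add_le _ _).trans (add_le_add ?_ ?_)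
  · rcases le_or_gt δ ‖y - x‖ with h | h
    · rw [radialCutoff_eq_zero hδ h, zero_mul, abs_zero]
      positivity
    · rw [abs_mul, abs_of_nonneg hc0]
      refine (mul_le_of_le_one_left (abs_nonneg _) hc1).trans ?_
      have hn : ‖y - x‖ ≤ 1 := h.le.trans hδ1
      have h1 : |(⟪y - x, b⟫ : ℝ)| ≤ ‖b‖ := (abs_real_inner_le_norm _ _).trans
        (mul_le_of_le_one_left (norm_nonneg _) hn)
      have h2 : ‖y - x‖ ^ 2 ≤ 1 := by nlinarith [norm_nonneg (y - x)]
      have h3 : (M + θ) * ‖y - x‖ ^ 2 ≤ M + θ := mul_le_of_le_one_right (by positivity) h2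
      have h4 : 0 ≤ (M + θ) * ‖y - x‖ ^ 2 := by positivity
      have h5 := abs_le.1 (hB x)
      have h6 := abs_le.1 h1
      rw [abs_le]
      constructor <;> linarith
  · rw [abs_mul, abs_of_nonneg (by linarith : 0 ≤ 1 - radialCutoff δ (y - x))]
    refine (mul_le_of_le_one_left (abs_nonneg _) (by linarith)).trans ?_
    have h1 : θ * min 1 (‖y - x‖ ^ 2) ≤ θ := mul_le_of_le_one_right hθ (min_le_left _ _)
    have h2 : 0 ≤ θ * min 1 (‖y - x‖ ^ 2) := by positivity
    have h5 := abs_le.1 (hB y)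
    rw [abs_le]
    constructor <;> linarith

lemma testAt_gluedTest (hu : Continuous u) (hδ : 0 < δ) (hδ1 : δ ≤ 1) (hM : 0 ≤ M) (hθ : 0 ≤ θ)
    (hB : ∀ y, |u y| ≤ B) : TestAt x (gluedTest u x b M θ δ) := by
  refine ⟨⟨_, abs_gluedTest_le hδ hδ1 hM hθ hB⟩, continuous_gluedTest hu, ?_⟩
  obtain ⟨U, hU, hEq⟩ := (gluedTest_eventuallyEq (u := u) (x := x) (b := b) (M := M) (θ := θ)
    hδ).exists_mem
  refine ⟨U, hU, ContDiffOn.congr ?_ hEq⟩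
  refine ContDiff.contDiffOn ?_
  have h1 : ContDiff ℝ 2 fun y : Rd d => y - x := contDiff_id.sub contDiff_const
  exact (contDiff_const.add (h1.inner ℝ contDiff_const)).sub
    (contDiff_const.mul (h1.norm_sq ℝ))

lemma gluedTest_lt (hδ : 0 < δ) (hθ : 0 < θ)
    (hq : ∀ z : Rd d, ‖z‖ ≤ δ → u x + ⟪z, b⟫ - M * ‖z‖ ^ 2 ≤ u (x + z)) {y : Rd d} (hy : y ≠ x) :
    gluedTest u x b M θ δ y < u y := by
  have hc0 := radialCutoff_nonneg (δ := δ) (y - x)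
  have hc1 := radialCutoff_le_one (δ := δ) (y - x)
  have hn : 0 < ‖y - x‖ := norm_pos_iff.2 (sub_ne_zero.2 hy)
  have hm : 0 < θ * min 1 (‖y - x‖ ^ 2) := by positivity
  have h2 : (1 - radialCutoff δ (y - x)) * (u y - θ * min 1 (‖y - x‖ ^ 2)) ≤
      (1 - radialCutoff δ (y - x)) * u y - (1 - radialCutoff δ (y - x)) *
        (θ * min 1 (‖y - x‖ ^ 2)) := by
    rw [mul_sub]
  have h1 : radialCutoff δ (y - x) * (u x + ⟪y - x, b⟫ - (M + θ) * ‖y - x‖ ^ 2) ≤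
      radialCutoff δ (y - x) * u y - radialCutoff δ (y - x) * (θ * min 1 (‖y - x‖ ^ 2)) := by
    rcases le_or_gt δ ‖y - x‖ with h | h
    · rw [radialCutoff_eq_zero hδ h]
      simp
    · rw [← mul_sub]
      refine mul_le_mul_of_nonneg_left ?_ hc0
      have h3 := hq (y - x) h.le
      rw [add_sub_cancel] at h3
      have h4 : θ * min 1 (‖y - x‖ ^ 2) ≤ θ * ‖y - x‖ ^ 2 := by
        gcongr
        exact min_le_right _ _
      linarith
  unfold gluedTest
  nlinarith

end GluedTest

namespace PsiSetting

variable {d : ℕ} (S : PsiSetting d) {u : Rd d → ℝ} {B : ℝ}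

lemma measurable_increment (hu : Continuous u) (x b : Rd d) :
    Measurable fun z : Rd d => u x - u (x + z) + drift b z :=
  (measurable_const.sub (by fun_prop)).add (measurable_drift b)

lemma abs_increment_le (hB : ∀ y, |u y| ≤ B) (x b z : Rd d) :
    |u x - u (x + z) + drift b z| ≤ 2 * B + ‖b‖ := by
  have h1 := abs_le.1 (hB x)
  have h2 := abs_le.1 (hB (x + z))
  have h3 := abs_le.1 (abs_drift_le b z)
  rw [abs_le]
  constructor <;> linarith

lemma integrableOn_increment (hu : Continuous u) (hB : ∀ y, |u y| ≤ B) (x b : Rd d) {η : ℝ}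
    (hη : 0 < η) : IntegrableOn (fun z : Rd d => (u x - u (x + z) + drift b z) * S.j ‖z‖)
      {z | η < ‖z‖} :=
  S.integrableOn_bdd_mul_j (S.integrableOn_j hη) (measurableSet_lt_norm η)
    (measurable_increment hu x b) fun z _ => abs_increment_le hB x b z

/-- The integrand of `Ψ(−Δ)` for the glued test function. -/
lemma gluedTest_increment {x b : Rd d} {M θ δ : ℝ} (hδ : 0 < δ) (hδ1 : δ ≤ 1) (z : Rd d) :
    gluedTest u x b M θ δ x - gluedTest u x b M θ δ (x + z) + drift b z =
      radialCutoff δ z * ((M + θ) * ‖z‖ ^ 2) +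
        (1 - radialCutoff δ z) * (u x - u (x + z) + drift b z + θ * min 1 (‖z‖ ^ 2)) := by
  rw [gluedTest_self hδ]
  unfold gluedTest
  rw [add_sub_cancel_left]
  rcases le_or_gt δ ‖z‖ with h | h
  · rw [radialCutoff_eq_zero hδ h]
    ring
  · have : drift b z = ⟪z, b⟫ := if_pos (h.le.trans hδ1)
    rw [this]
    ring

lemma integrable_gluedTest_increment (hu : Continuous u) (hB : ∀ y, |u y| ≤ B) {x b : Rd d}
    {M θ δ : ℝ} (hδ : 0 < δ) (hδ1 : δ ≤ 1) (hM : 0 ≤ M) (hθ : 0 ≤ θ) :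
    Integrable fun z : Rd d =>
      (gluedTest u x b M θ δ x - gluedTest u x b M θ δ (x + z) + drift b z) * S.j ‖z‖ := by
  set D : ℝ := 2 * ((B + ‖b‖ + (M + θ)) + (B + θ)) + ‖b‖ with hD
  have hB' := abs_gluedTest_le (u := u) (x := x) (b := b) hδ hδ1 hM hθ hB
  have hD0 : 0 ≤ D := (abs_nonneg _).trans (abs_increment_le hB' x b 0)
  refine Integrable.mono' (g := fun z : Rd d => ((M + θ) + D * ((δ / 2) ^ 2)⁻¹) *
    (min 1 (‖z‖ ^ 2) * S.j ‖z‖)) (S.integrable_min_mul_j.const_mul _)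
    ((measurable_increment (continuous_gluedTest hu) x b).mul
      S.measurable_j_norm).aestronglyMeasurable (ae_of_all _ fun z => ?_)
  have hκ : 0 ≤ min 1 (‖z‖ ^ 2) * S.j ‖z‖ := mul_nonneg (by positivity) (S.j_nonneg _)
  rw [norm_mul, Real.norm_of_nonneg (S.j_nonneg _), add_mul, Real.norm_eq_abs]
  rcases le_or_gt ‖z‖ (δ / 2) with h | h
  · rw [gluedTest_increment hδ hδ1, radialCutoff_eq_one hδ h, sub_self, zero_mul, add_zero, one_mul,
      abs_of_nonneg (by positivity)]
    have h1 : ‖z‖ ^ 2 ≤ 1 := by nlinarith [norm_nonneg z]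
    rw [min_eq_right h1, mul_assoc]
    rw [min_eq_right h1] at hκ
    exact le_add_of_nonneg_right (by positivity)
  · have h1 := S.j_le_min_mul_j (half_pos hδ) (by linarith) h
    have h2 := mul_le_mul (abs_increment_le hB' x b z) h1 (S.j_nonneg _) hD0
    rw [← mul_assoc D] at h2
    refine h2.trans (le_add_of_nonneg_left (by positivity))

/-- A supersolution touched from below by a paraboloid satisfies the equation with the function
itself in place of the test function away from the contact point. -/
lemma le_integral_of_touching (hu : Continuous u) (hB : ∀ y, |u y| ≤ B) {x b : Rd d}
    {g M r : ℝ} (hM : 0 ≤ M)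
    (hv : ∀ φ : Rd d → ℝ, TestAt x φ → φ x = u x → (∀ y, y ≠ x → φ y < u y) → g ≤ psiOp S φ x)
    (hq : ∀ z : Rd d, ‖z‖ ≤ r → u x + ⟪z, b⟫ - M * ‖z‖ ^ 2 ≤ u (x + z))
    {δ : ℝ} (hδ : 0 < δ) (hδr : δ ≤ r) (hδ1 : δ ≤ 1) :
    g ≤ (∫ z in {z : Rd d | δ < ‖z‖}, (u x - u (x + z) + drift b z) * S.j ‖z‖) +
      M * S.smallMass δ := by
  set K : ℝ := ∫ z : Rd d, min 1 (‖z‖ ^ 2) * S.j ‖z‖ with hK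
  have hκ : ∀ z : Rd d, 0 ≤ min 1 (‖z‖ ^ 2) * S.j ‖z‖ := fun z =>
    mul_nonneg (by positivity) (S.j_nonneg _)
  have hK0 : 0 ≤ K := integral_nonneg hκ
  have key : ∀ θ : ℝ, 0 < θ → g ≤ ((∫ z in {z : Rd d | δ < ‖z‖},
      (u x - u (x + z) + drift b z) * S.j ‖z‖) + M * S.smallMass δ) + θ * K := by
    intro θ hθ
    refine (hv _ (testAt_gluedTest (b := b) (M := M) (θ := θ) hu hδ hδ1 hM hθ.le hB)
      (gluedTest_self hδ) fun y hy => gluedTest_lt hδ hθ (fun z hz => hq z (hz.trans hδr)) hy).trans ?_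
    unfold psiOp
    rw [gradient_gluedTest hδ]
    have hI1 := (integrable_indicator_iff (measurableSet_norm_le (d := d) δ)).2
      (S.integrable_min_mul_j.const_mul M).integrableOn
    have hI2 := (integrable_indicator_iff (measurableSet_lt_norm (d := d) δ)).2
      (S.integrableOn_increment hu hB x b hδ)
    have hI12 : Integrable fun z : Rd d => {z : Rd d | δ < ‖z‖}.indicator
          (fun z => (u x - u (x + z) + drift b z) * S.j ‖z‖) z +
        {z : Rd d | ‖z‖ ≤ δ}.indicator (fun z => M * (min 1 (‖z‖ ^ 2) * S.j ‖z‖)) z :=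
      hI2.add hI1
    have hle : ∀ z : Rd d, (gluedTest u x b M θ δ x - gluedTest u x b M θ δ (x + z) + drift b z) *
        S.j ‖z‖ ≤ {z : Rd d | δ < ‖z‖}.indicator
          (fun z => (u x - u (x + z) + drift b z) * S.j ‖z‖) z +
        {z : Rd d | ‖z‖ ≤ δ}.indicator (fun z => M * (min 1 (‖z‖ ^ 2) * S.j ‖z‖)) z +
        θ * (min 1 (‖z‖ ^ 2) * S.j ‖z‖) := by
      intro z
      rw [gluedTest_increment hδ hδ1]
      rcases lt_or_ge δ ‖z‖ with h | h
      · rw [indicator_of_mem (show z ∈ {z : Rd d | δ < ‖z‖} from h),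
          indicator_of_notMem (show z ∉ {z : Rd d | ‖z‖ ≤ δ} from not_le.2 h),
          radialCutoff_eq_zero hδ h.le]
        apply le_of_eq
        ring
      · rw [indicator_of_notMem (show z ∉ {z : Rd d | δ < ‖z‖} from not_lt.2 h),
          indicator_of_mem (show z ∈ {z : Rd d | ‖z‖ ≤ δ} from h)]
        have hz1 : ‖z‖ ^ 2 ≤ 1 := by nlinarith [norm_nonneg z]
        have hd : drift b z = ⟪z, b⟫ := if_pos (h.trans hδ1)
        rw [min_eq_right hz1, hd, zero_add]
        have h2 : M * (‖z‖ ^ 2 * S.j ‖z‖) + θ * (‖z‖ ^ 2 * S.j ‖z‖) =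
            (M * ‖z‖ ^ 2 + θ * ‖z‖ ^ 2) * S.j ‖z‖ := by ring
        rw [h2]
        refine mul_le_mul_of_nonneg_right ?_ (S.j_nonneg _)
        have h1 := hq z (h.trans hδr)
        have hc1 := radialCutoff_le_one (δ := δ) z
        nlinarith
    calc
      _ ≤ ∫ z : Rd d, ({z : Rd d | δ < ‖z‖}.indicator
          (fun z => (u x - u (x + z) + drift b z) * S.j ‖z‖) z +
        {z : Rd d | ‖z‖ ≤ δ}.indicator (fun z => M * (min 1 (‖z‖ ^ 2) * S.j ‖z‖)) z +
        θ * (min 1 (‖z‖ ^ 2) * S.j ‖z‖)) :=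
          integral_mono (S.integrable_gluedTest_increment hu hB hδ hδ1 hM hθ.le)
            (hI12.add (S.integrable_min_mul_j.const_mul θ)) hle
      _ = _ := by
          rw [integral_add hI12 (S.integrable_min_mul_j.const_mul θ),
            integral_add hI2 hI1, integral_indicator (measurableSet_lt_norm δ),
            integral_indicator (measurableSet_norm_le δ), integral_const_mul, integral_const_mul]
          rfl
  refine le_of_forall_pos_le_add fun ε hε => ?_
  refine (key (ε / (K + 1)) (by positivity)).trans ?_
  gcongr
  rw [div_mul_eq_mul_div, div_le_iff₀ (by positivity)]
  nlinarith

lemma gradient_neg {φ : Rd d → ℝ} (x : Rd d) : gradient (-φ) x = -gradient φ x := by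
  unfold gradient
  rw [fderiv_neg, map_neg]

lemma psiOp_neg (φ : Rd d → ℝ) (x : Rd d) : psiOp S (-φ) x = -psiOp S φ x := by
  unfold psiOp
  rw [← integral_neg, gradient_neg]
  refine integral_congr_ae (ae_of_all _ fun z => ?_)
  simp only [Pi.neg_apply, inner_neg_right]
  split_ifs <;> ring

/-- The counterpart of `le_integral_of_touching` for subsolutions touched from above, expressed in
coordinates transformed by a linear isometry. -/
lemma le_integral_of_touching_above (hu : Continuous u) (hB : ∀ y, |u y| ≤ B) {x b : Rd d}
    {g M r : ℝ} (hM : 0 ≤ M) (σ : Rd d ≃ₗᵢ[ℝ] Rd d)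
    (hv : ∀ φ : Rd d → ℝ, TestAt x φ → φ x = u x → (∀ y, y ≠ x → u y < φ y) → psiOp S φ x ≤ g)
    (hq : ∀ z : Rd d, ‖z‖ ≤ r → u (x + σ z) ≤ u x + ⟪z, b⟫ + M * ‖z‖ ^ 2)
    {δ : ℝ} (hδ : 0 < δ) (hδr : δ ≤ r) (hδ1 : δ ≤ 1) :
    -g ≤ (∫ z in {z : Rd d | δ < ‖z‖}, (u (x + σ z) - u x - drift b z) * S.j ‖z‖) +
      M * S.smallMass δ := by
  have h := S.le_integral_of_touching (u := -u) (B := B) (x := x) (b := -σ b) (g := -g) (M := M)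
    (r := r) hu.neg (fun y => by simpa using hB y) hM ?_ ?_ hδ hδr hδ1
  · have h2 := (σ.measurePreserving.setIntegral_preimage_emb σ.toMeasurableEquiv.measurableEmbedding
      (fun z : Rd d => ((-u) x - (-u) (x + z) + drift (-σ b) z) * S.j ‖z‖) {z | δ < ‖z‖})
    have hpre : σ ⁻¹' {z : Rd d | δ < ‖z‖} = {z : Rd d | δ < ‖z‖} := by
      ext z
      simp
    rw [hpre] at h2
    rw [← h2] at h
    refine h.trans_eq ?_
    congr 1
    refine integral_congr_ae (ae_of_all _ fun z => ?_)
    simp only [Pi.neg_apply, LinearIsometryEquiv.norm_map, drift, inner_neg_right,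
      LinearIsometryEquiv.inner_map_map]
    split_ifs <;> ring
  · intro φ hφ hφx hlt
    have := hv (-φ) ⟨?_, hφ.2.1.neg, ?_⟩ (by simp [hφx]) fun y hy => by
      have := hlt y hy
      simp only [Pi.neg_apply] at this ⊢
      linarith
    · rw [psiOp_neg] at this
      linarith
    · obtain ⟨M', hM'⟩ := hφ.1
      exact ⟨M', fun y => by simpa using hM' y⟩
    · obtain ⟨U, hU, hc⟩ := hφ.2.2
      exact ⟨U, hU, hc.neg⟩
  · intro z hz
    have := hq (σ.symm z) (by simpa using hz)
    have h3 : (⟪σ.symm z, b⟫ : ℝ) = ⟪z, σ b⟫ := by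
      rw [← σ.inner_map_map, σ.apply_symm_apply]
    rw [σ.apply_symm_apply, h3, LinearIsometryEquiv.norm_map] at this
    simp only [Pi.neg_apply, inner_neg_right]
    linarith

end PsiSetting

namespace PsiSetting

variable {d : ℕ} (S : PsiSetting d) {u : Rd d → ℝ} {B : ℝ}

lemma tendsto_smallMass : Tendsto S.smallMass (𝓝[>] 0) (𝓝 0) := by
  have h : Tendsto (fun δ : ℝ => ∫ z : Rd d, {z : Rd d | ‖z‖ ≤ δ}.indicator
      (fun z => min 1 (‖z‖ ^ 2) * S.j ‖z‖) z) (𝓝[>] 0) (𝓝 (∫ _ : Rd d, (0 : ℝ))) := by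
    refine tendsto_integral_filter_of_dominated_convergence
      (fun z => min 1 (‖z‖ ^ 2) * S.j ‖z‖) (Eventually.of_forall fun δ =>
        (S.integrable_min_mul_j.indicator (measurableSet_norm_le δ)).aestronglyMeasurable)
      (Eventually.of_forall fun δ => ae_of_all _ fun z => ?_) S.integrable_min_mul_j
      (ae_of_all _ fun z => ?_)
    · refine (norm_indicator_le_norm_self _ _).trans_eq (Real.norm_of_nonneg ?_)
      exact mul_nonneg (by positivity) (S.j_nonneg _)
    · refine tendsto_const_nhds.congr' ?_
      rcases eq_or_ne z 0 with rfl | hz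
      · refine Eventually.of_forall fun δ => ?_
        simp [indicator]
      · filter_upwards [Ioo_mem_nhdsGT (norm_pos_iff.2 hz)] with δ hδ
        rw [indicator_of_notMem (show z ∉ {z : Rd d | ‖z‖ ≤ δ} from not_le.2 hδ.2)]
  rw [integral_zero] at h
  refine h.congr fun δ => ?_
  rw [integral_indicator (measurableSet_norm_le δ)]
  rfl

lemma integrableOn_double_increment (hu : Continuous u) (hB : ∀ y, |u y| ≤ B)
    (σ : Rd d ≃ₗᵢ[ℝ] Rd d) (x y b : Rd d) {η : ℝ} (hη : 0 < η) :
    IntegrableOn (fun z : Rd d =>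
      (u x - u (x + z) - u y + u (y + σ z) + drift b z) * S.j ‖z‖) {z | η < ‖z‖} := by
  refine S.integrableOn_bdd_mul_j (C := 4 * B + ‖b‖) (S.integrableOn_j hη)
    (measurableSet_lt_norm η) ?_ fun z _ => ?_
  · exact (Continuous.measurable (by fun_prop)).add (measurable_drift b)
  · have h1 := abs_le.1 (hB x)
    have h2 := abs_le.1 (hB (x + z))
    have h3 := abs_le.1 (hB y)
    have h4 := abs_le.1 (hB (y + σ z))
    have h5 := abs_le.1 (abs_drift_le b z)
    rw [abs_le]
    constructor <;> linarith

/-- The doubled inequality obtained from a supersolution touched from below at `x` and a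
subsolution touched from above at `y`, when the joint increments are controlled near `0`. -/
lemma sub_le_integral_of_double_touching (hu : Continuous u) (hB : ∀ y, |u y| ≤ B)
    (σ : Rd d ≃ₗᵢ[ℝ] Rd d) {x y b b' : Rd d} {g g' M M' r : ℝ} (hM : 0 ≤ M) (hM' : 0 ≤ M')
    (hv : ∀ φ : Rd d → ℝ, TestAt x φ → φ x = u x → (∀ y, y ≠ x → φ y < u y) → g ≤ psiOp S φ x)
    (hv' : ∀ φ : Rd d → ℝ, TestAt y φ → φ y = u y → (∀ x, x ≠ y → u x < φ x) → psiOp S φ y ≤ g')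
    (hq : ∀ z : Rd d, ‖z‖ ≤ r → u x + ⟪z, b⟫ - M * ‖z‖ ^ 2 ≤ u (x + z))
    (hq' : ∀ z : Rd d, ‖z‖ ≤ r → u (y + σ z) ≤ u y + ⟪z, b'⟫ + M' * ‖z‖ ^ 2)
    (hqq : ∀ z : Rd d, ‖z‖ ≤ r →
      u x - u (x + z) - u y + u (y + σ z) + ⟪z, b - b'⟫ ≤ ‖z‖ ^ 2)
    {η : ℝ} (hη : 0 < η) (hηr : η ≤ r) (hη1 : η ≤ 1) :
    g - g' ≤ (∫ z in {z : Rd d | η < ‖z‖},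
      (u x - u (x + z) - u y + u (y + σ z) + drift (b - b') z) * S.j ‖z‖) + S.smallMass η := by
  have key : ∀ δ ∈ Ioo 0 η, g - g' ≤ ((∫ z in {z : Rd d | η < ‖z‖},
      (u x - u (x + z) - u y + u (y + σ z) + drift (b - b') z) * S.j ‖z‖) + S.smallMass η) +
      (M + M') * S.smallMass δ := by
    intro δ hδ
    have h1 := S.le_integral_of_touching hu hB hM hv hq hδ.1 (hδ.2.le.trans hηr)
      (hδ.2.le.trans hη1)
    have h2 := S.le_integral_of_touching_above hu hB hM' σ hv' hq' hδ.1 (hδ.2.le.trans hηr)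
      (hδ.2.le.trans hη1)
    have hI := S.integrableOn_double_increment hu hB σ x y (b - b') hδ.1
    have h3 : (∫ z in {z : Rd d | δ < ‖z‖}, (u x - u (x + z) + drift b z) * S.j ‖z‖) +
        (∫ z in {z : Rd d | δ < ‖z‖}, (u (y + σ z) - u y - drift b' z) * S.j ‖z‖) =
        ∫ z in {z : Rd d | δ < ‖z‖},
          (u x - u (x + z) - u y + u (y + σ z) + drift (b - b') z) * S.j ‖z‖ := by
      have hI1 := S.integrableOn_increment hu hB x b hδ.1
      have hI2 : IntegrableOn (fun z : Rd d => (u (y + σ z) - u y - drift b' z) * S.j ‖z‖)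
          {z : Rd d | δ < ‖z‖} := by
        refine (hI.sub hI1).congr_fun (fun z _ => ?_) (measurableSet_lt_norm δ)
        simp only [Pi.sub_apply, drift_sub]
        ring
      rw [← integral_add hI1 hI2]
      refine integral_congr_ae (ae_of_all _ fun z => ?_)
      simp only [drift_sub]
      ring
    have hunion : {z : Rd d | δ < ‖z‖} =
        {z : Rd d | η < ‖z‖} ∪ {z : Rd d | δ < ‖z‖ ∧ ‖z‖ ≤ η} := by
      ext z
      simp only [Set.mem_union, Set.mem_ofPred_eq]
      constructor
      · intro h
        rcases lt_or_ge η ‖z‖ with h' | h'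
        · exact Or.inl h'
        · exact Or.inr ⟨h, h'⟩
      · rintro (h | h)
        · exact hδ.2.trans h
        · exact h.1
    have hmeas : MeasurableSet {z : Rd d | δ < ‖z‖ ∧ ‖z‖ ≤ η} :=
      (measurableSet_lt_norm δ).inter (measurableSet_norm_le η)
    have h4 : (∫ z in {z : Rd d | δ < ‖z‖},
          (u x - u (x + z) - u y + u (y + σ z) + drift (b - b') z) * S.j ‖z‖) ≤
        (∫ z in {z : Rd d | η < ‖z‖},
          (u x - u (x + z) - u y + u (y + σ z) + drift (b - b') z) * S.j ‖z‖) +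
          S.smallMass η := by
      rw [hunion, setIntegral_union ?_ hmeas (hI.mono_set (by rw [hunion]; exact subset_union_left))
        (hI.mono_set (by rw [hunion]; exact subset_union_right))]
      · gcongr
        calc
          _ ≤ ∫ z in {z : Rd d | δ < ‖z‖ ∧ ‖z‖ ≤ η}, min 1 (‖z‖ ^ 2) * S.j ‖z‖ := by
            refine setIntegral_mono_on (hI.mono_set fun z hz => hz.1)
              S.integrable_min_mul_j.integrableOn hmeas fun z hz => ?_
            refine mul_le_mul_of_nonneg_right ?_ (S.j_nonneg _)
            have hz1 : ‖z‖ ≤ 1 := hz.2.trans hη1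
            rw [min_eq_right (by nlinarith [norm_nonneg z])]
            have : drift (b - b') z = ⟪z, b - b'⟫ := if_pos hz1
            rw [this]
            exact hqq z (hz.2.trans hηr)
          _ ≤ _ := setIntegral_mono_set S.integrable_min_mul_j.integrableOn
            (ae_of_all _ fun z => mul_nonneg (by positivity) (S.j_nonneg _))
            (Eventually.of_forall fun z hz => hz.2)
      · refine disjoint_left.2 fun z hz hz' => not_lt.2 hz'.2 hz
    linarith
  have hlim : Tendsto (fun δ => ((∫ z in {z : Rd d | η < ‖z‖},
      (u x - u (x + z) - u y + u (y + σ z) + drift (b - b') z) * S.j ‖z‖) + S.smallMass η) +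
      (M + M') * S.smallMass δ) (𝓝[>] 0) (𝓝 (((∫ z in {z : Rd d | η < ‖z‖},
      (u x - u (x + z) - u y + u (y + σ z) + drift (b - b') z) * S.j ‖z‖) + S.smallMass η) +
      (M + M') * 0)) := (S.tendsto_smallMass.const_mul _).const_add _
  rw [mul_zero, add_zero] at hlim
  refine ge_of_tendsto hlim ?_
  filter_upwards [Ioo_mem_nhdsGT hη] with δ hδ using key δ hδ

end PsiSetting

/-- Doubling of variables at a local maximum of `v - u`. -/
lemma exists_doubling_points {d : ℕ} {u v : Rd d → ℝ} {B r : ℝ} {x₀ : Rd d} (hu : Continuous u)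
    (hv : UniformContinuous v) (huB : ∀ y, |u y| ≤ B) (hvB : ∀ y, |v y| ≤ B) (hr : 0 < r)
    (hmax : ∀ x ∈ closedBall x₀ r, v x - u x ≤ v x₀ - u x₀) :
    ∃ X Y : ℕ → Rd d, Tendsto X atTop (𝓝 x₀) ∧ Tendsto Y atTop (𝓝 x₀) ∧
      ∀ k : ℕ, ∀ x ∈ closedBall x₀ r, ∀ y ∈ closedBall x₀ r,
        v y - u x - k * ‖x - y‖ ^ 2 - ‖x - x₀‖ ^ 2 ≤
          v (Y k) - u (X k) - k * ‖X k - Y k‖ ^ 2 - ‖X k - x₀‖ ^ 2 := by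
  have hvc := hv.continuous
  have hx₀ : x₀ ∈ closedBall x₀ r := mem_closedBall_self hr.le
  have hex : ∀ k : ℕ, ∃ p ∈ closedBall x₀ r ×ˢ closedBall x₀ r,
      IsMaxOn (fun p : Rd d × Rd d => v p.2 - u p.1 - k * ‖p.1 - p.2‖ ^ 2 - ‖p.1 - x₀‖ ^ 2)
        (closedBall x₀ r ×ˢ closedBall x₀ r) p := fun k =>
    ((isCompact_closedBall x₀ r).prod (isCompact_closedBall x₀ r)).exists_isMaxOn
      ⟨(x₀, x₀), hx₀, hx₀⟩ (by fun_prop)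
  choose p hp hpmax using hex
  have hkey : ∀ k : ℕ, v x₀ - u x₀ ≤ v (p k).2 - u (p k).1 - k * ‖(p k).1 - (p k).2‖ ^ 2 -
      ‖(p k).1 - x₀‖ ^ 2 := fun k => by
    have := hpmax k (show (x₀, x₀) ∈ closedBall x₀ r ×ˢ closedBall x₀ r from ⟨hx₀, hx₀⟩)
    simpa using this
  have hdist : Tendsto (fun k => dist (p k).1 (p k).2) atTop (𝓝 0) := by
    have h1 : Tendsto (fun k : ℕ => Real.sqrt (4 * B / k)) atTop (𝓝 0) := by
      have := (tendsto_const_div_atTop_nhds_zero_nat (4 * B)).sqrt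
      rwa [Real.sqrt_zero] at this
    refine tendsto_of_tendsto_of_tendsto_of_le_of_le' tendsto_const_nhds h1
      (Eventually.of_forall fun k => dist_nonneg) ?_
    filter_upwards [eventually_gt_atTop 0] with k hk
    have hk' : (0 : ℝ) < k := by exact_mod_cast hk
    refine Real.le_sqrt_of_sq_le ?_
    rw [le_div_iff₀ hk', dist_eq_norm]
    have h2 := abs_le.1 (huB x₀)
    have h3 := abs_le.1 (hvB x₀)
    have h4 := abs_le.1 (huB (p k).1)
    have h5 := abs_le.1 (hvB (p k).2)
    have h6 := hkey k
    have h7 := sq_nonneg ‖(p k).1 - x₀‖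
    linarith
  have hX : Tendsto (fun k => (p k).1) atTop (𝓝 x₀) := by
    rw [tendsto_iff_dist_tendsto_zero]
    have h1 : Tendsto (fun k => dist (v (p k).1) (v (p k).2)) atTop (𝓝 0) :=
      tendsto_uniformity_iff_dist_tendsto_zero.1
        (Tendsto.comp hv (tendsto_uniformity_iff_dist_tendsto_zero.2 hdist))
    have h2 := h1.sqrt
    rw [Real.sqrt_zero] at h2
    refine squeeze_zero (fun k => dist_nonneg) (fun k => Real.le_sqrt_of_sq_le ?_) h2
    rw [dist_eq_norm, Real.dist_eq]
    have h3 := hkey k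
    have h4 := hmax _ (hp k).1
    have h5 : 0 ≤ (k : ℝ) * ‖(p k).1 - (p k).2‖ ^ 2 := by positivity
    have h6 := neg_abs_le (v (p k).1 - v (p k).2)
    linarith
  refine ⟨fun k => (p k).1, fun k => (p k).2, hX, ?_, fun k x hx y hy =>
    hpmax k (show (x, y) ∈ closedBall x₀ r ×ˢ closedBall x₀ r from ⟨hx, hy⟩)⟩
  have : Tendsto (fun k => dist (p k).1 (p k).2 + dist (p k).1 x₀) atTop (𝓝 (0 + 0)) :=
    hdist.add (tendsto_iff_dist_tendsto_zero.1 hX)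
  rw [add_zero] at this
  rw [tendsto_iff_dist_tendsto_zero]
  exact squeeze_zero (fun k => dist_nonneg) (fun k => dist_triangle_left _ _ _) this

section Reflection

variable {d : ℕ} {e : Rd d} {μ : ℝ}

/-- The linear part of `reflAt e μ`. -/
def reflLin (e : Rd d) : Rd d ≃ₗᵢ[ℝ] Rd d := (ℝ ∙ e)ᗮ.reflection

lemma reflLin_apply (he : ‖e‖ = 1) (z : Rd d) : reflLin e z = z - (2 * ⟪z, e⟫) • e := by
  rw [reflLin, Submodule.reflection_orthogonal_apply, Submodule.reflection_singleton_apply, he,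
    real_inner_comm]
  simp [two_smul, add_smul, two_mul]

lemma reflAt_add (he : ‖e‖ = 1) (y z : Rd d) : reflAt e μ (y + z) = reflAt e μ y + reflLin e z := by
  rw [reflLin_apply he]
  unfold reflAt
  rw [inner_add_left]
  module

lemma inner_reflAt (he : ‖e‖ = 1) (x : Rd d) : ⟪reflAt e μ x, e⟫ = 2 * μ - ⟪x, e⟫ := by
  unfold reflAt
  rw [inner_sub_left, real_inner_smul_left, real_inner_self_eq_norm_sq, he]
  ring

lemma reflAt_reflAt (he : ‖e‖ = 1) (x : Rd d) : reflAt e μ (reflAt e μ x) = x := by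
  have h := inner_reflAt (μ := μ) he x
  rw [reflAt, h]
  unfold reflAt
  module

lemma dist_reflAt (he : ‖e‖ = 1) (x y : Rd d) : dist (reflAt e μ x) (reflAt e μ y) = dist x y := by
  have := reflAt_add (μ := μ) he y (x - y)
  rw [add_sub_cancel] at this
  rw [this, dist_eq_norm, add_sub_cancel_left, LinearIsometryEquiv.norm_map, dist_eq_norm]

lemma reflAt_of_inner_eq {x : Rd d} (h : ⟪x, e⟫ = μ) : reflAt e μ x = x := by
  unfold reflAt
  rw [h]
  simp

lemma continuous_reflAt : Continuous fun p : ℝ × Rd d => reflAt e p.1 p.2 := by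
  unfold reflAt
  fun_prop

end Reflection

namespace PsiSetting

variable {d : ℕ} (S : PsiSetting d) {u : Rd d → ℝ} {B : ℝ}

/-- At a local minimum `x₀` of `u - u ∘ R`, where `R` is a hyperplane reflection, viscosity
solutions satisfy the linearised inequality for the difference up to the mass of small jumps. -/
lemma sub_le_integral_antisymm (hu : UniformContinuous u) (hB : ∀ y, |u y| ≤ B)
    {e : Rd d} (he : ‖e‖ = 1) {μ r : ℝ} {x₀ : Rd d} {g : Rd d → ℝ} (hg : Continuous g)
    (hr : 0 < r)
    (hsup : ∀ x ∈ closedBall x₀ r, ∀ φ : Rd d → ℝ, TestAt x φ → φ x = u x →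
      (∀ y, y ≠ x → φ y < u y) → g x ≤ psiOp S φ x)
    (hsub : ∀ x ∈ closedBall x₀ r, ∀ φ : Rd d → ℝ, TestAt (reflAt e μ x) φ →
      φ (reflAt e μ x) = u (reflAt e μ x) → (∀ y, y ≠ reflAt e μ x → u y < φ y) →
      psiOp S φ (reflAt e μ x) ≤ g (reflAt e μ x))
    (hmin : ∀ x ∈ closedBall x₀ r,
      u x₀ - u (reflAt e μ x₀) ≤ u x - u (reflAt e μ x))
    {η : ℝ} (hη : 0 < η) (hηr : η ≤ r / 2) (hη1 : η ≤ 1) :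
    g x₀ - g (reflAt e μ x₀) ≤ (∫ z in {z : Rd d | η < ‖z‖},
      ((u x₀ - u (reflAt e μ x₀)) - (u (x₀ + z) - u (reflAt e μ (x₀ + z)))) * S.j ‖z‖) +
        S.smallMass η := by
  have huc := hu.continuous
  have hRc : Continuous (reflAt e μ) := continuous_reflAt.comp (by fun_prop : Continuous
    fun x : Rd d => (μ, x))
  have hRu : UniformContinuous (reflAt e μ) :=
    (Isometry.of_dist_eq (dist_reflAt he)).uniformContinuous
  obtain ⟨X, Y, hX, hY, hXY⟩ := exists_doubling_points (u := u) (v := fun y => u (reflAt e μ y))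
    (x₀ := x₀) huc (hu.comp hRu) hB (fun y => hB _) hr fun x hx => by linarith [hmin x hx]
  have hstep : ∀ᶠ k in atTop, g (X k) - g (reflAt e μ (Y k)) ≤ (∫ z in {z : Rd d | η < ‖z‖},
      (u (X k) - u (X k + z) - u (reflAt e μ (Y k)) + u (reflAt e μ (Y k) + reflLin e z) +
        drift ((-2 : ℝ) • (X k - x₀)) z) * S.j ‖z‖) + S.smallMass η := by
    filter_upwards [hX.eventually (closedBall_mem_nhds x₀ (half_pos hr)),
      hY.eventually (closedBall_mem_nhds x₀ (half_pos hr))] with k hXk hYk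
    rw [dist_eq_norm] at hXk hYk
    have hmem : ∀ {p z : Rd d}, ‖p - x₀‖ ≤ r / 2 → ‖z‖ ≤ r / 2 → p + z ∈ closedBall x₀ r := by
      intro p z hp hz
      rw [mem_closedBall, dist_eq_norm, add_sub_right_comm]
      exact (norm_add_le _ _).trans (by linarith)
    have hX0 : X k ∈ closedBall x₀ r := by
      simpa using hmem hXk (z := 0) (by simpa using (half_pos hr).le)
    have hY0 : Y k ∈ closedBall x₀ r := by
      simpa using hmem hYk (z := 0) (by simpa using (half_pos hr).le)
    set D : Rd d := X k - Y k with hD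
    set E : Rd d := X k - x₀ with hE
    have hE1 : ∀ z : Rd d, ‖X k + z - x₀‖ ^ 2 = ‖E‖ ^ 2 + 2 * ⟪z, E⟫ + ‖z‖ ^ 2 := fun z => by
      rw [add_sub_right_comm, ← hE, norm_add_sq_real, real_inner_comm]
    have hD1 : ∀ z : Rd d, ‖X k + z - Y k‖ ^ 2 = ‖D‖ ^ 2 + 2 * ⟪z, D⟫ + ‖z‖ ^ 2 := fun z => by
      rw [add_sub_right_comm, ← hD, norm_add_sq_real, real_inner_comm]
    have hD2 : ∀ z : Rd d, ‖X k - (Y k + z)‖ ^ 2 = ‖D‖ ^ 2 - 2 * ⟪z, D⟫ + ‖z‖ ^ 2 := fun z => by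
      rw [← sub_sub, ← hD, norm_sub_sq_real, real_inner_comm]
    have hD3 : ∀ z : Rd d, X k + z - (Y k + z) = D := fun z => by
      rw [add_sub_add_right_eq_sub]
    have hbb : (-(2 * (k : ℝ))) • D + (-2 : ℝ) • E - (-(2 * (k : ℝ))) • D = (-2 : ℝ) • E := by
      module
    have := S.sub_le_integral_of_double_touching huc hB (reflLin e) (x := X k)
      (y := reflAt e μ (Y k)) (b := (-(2 * (k : ℝ))) • D + (-2 : ℝ) • E)
      (b' := (-(2 * (k : ℝ))) • D) (M := k + 1) (M' := k) (r := r / 2) (by positivity)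
      (by positivity) (hsup _ hX0) (hsub _ hY0) ?_ ?_ ?_ hη hηr hη1
    · rwa [hbb] at this
    · intro z hz
      have h := hXY k _ (hmem hXk hz) _ hY0
      rw [hE1, hD1] at h
      rw [inner_add_right, real_inner_smul_right, real_inner_smul_right]
      linarith
    · intro z hz
      have h := hXY k _ hX0 _ (hmem hYk hz)
      rw [hD2, reflAt_add he] at h
      rw [real_inner_smul_right]
      linarith
    · intro z hz
      have h := hXY k _ (hmem hXk hz) _ (hmem hYk hz)
      rw [hD3, hE1, reflAt_add he] at h
      rw [hbb, real_inner_smul_right]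
      linarith
  have hlimI : Tendsto (fun k => ∫ z in {z : Rd d | η < ‖z‖},
      (u (X k) - u (X k + z) - u (reflAt e μ (Y k)) + u (reflAt e μ (Y k) + reflLin e z) +
        drift ((-2 : ℝ) • (X k - x₀)) z) * S.j ‖z‖) atTop (𝓝 (∫ z in {z : Rd d | η < ‖z‖},
      ((u x₀ - u (reflAt e μ x₀)) - (u (x₀ + z) - u (reflAt e μ (x₀ + z)))) * S.j ‖z‖)) := by
    have hb : Tendsto (fun k => (-2 : ℝ) • (X k - x₀)) atTop (𝓝 0) := by
      have := (hX.sub_const x₀).const_smul (-2 : ℝ)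
      rwa [sub_self, smul_zero] at this
    have hRY : Tendsto (fun k => reflAt e μ (Y k)) atTop (𝓝 (reflAt e μ x₀)) :=
      (hRc.tendsto _).comp hY
    refine tendsto_integral_filter_of_dominated_convergence
      (fun z => (4 * B + 1) * S.j ‖z‖) (Eventually.of_forall fun k =>
        (S.integrableOn_double_increment huc hB (reflLin e) (X k) (reflAt e μ (Y k)) _
          hη).aestronglyMeasurable) ?_ ((S.integrableOn_j hη).const_mul _) ?_
    · filter_upwards [(tendsto_norm_zero.comp hb).eventually (gt_mem_nhds one_pos)] with k hk
      refine ae_of_all _ fun z => ?_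
      rw [norm_mul, Real.norm_of_nonneg (S.j_nonneg _), Real.norm_eq_abs]
      refine mul_le_mul_of_nonneg_right ?_ (S.j_nonneg _)
      have h1 := abs_le.1 (hB (X k))
      have h2 := abs_le.1 (hB (X k + z))
      have h3 := abs_le.1 (hB (reflAt e μ (Y k)))
      have h4 := abs_le.1 (hB (reflAt e μ (Y k) + reflLin e z))
      have h5 := abs_le.1 ((abs_drift_le ((-2 : ℝ) • (X k - x₀)) z).trans (le_of_lt hk))
      rw [abs_le]
      constructor <;> linarith
    · refine ae_of_all _ fun z => Tendsto.mul_const _ ?_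
      have hd : Tendsto (fun k => drift ((-2 : ℝ) • (X k - x₀)) z) atTop (𝓝 0) :=
        squeeze_zero_norm (fun k => abs_drift_le _ _) (tendsto_norm_zero.comp hb)
      have h := ((((huc.tendsto _).comp hX).sub ((huc.tendsto _).comp (hX.add_const z))).sub
        ((huc.tendsto _).comp hRY)).add ((huc.tendsto _).comp (hRY.add_const (reflLin e z)))
      have h' := h.add hd
      rw [← reflAt_add he] at h'
      refine h'.trans_eq ?_
      congr 1
      ring
  refine le_of_tendsto_of_tendsto (((hg.tendsto _).comp hX).sub
    ((hg.tendsto _).comp ((hRc.tendsto _).comp hY))) (hlimI.add_const _) hstep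

end PsiSetting

section ReflectionMeasure

variable {d : ℕ} {e : Rd d}

lemma isometry_reflAt (he : ‖e‖ = 1) (μ : ℝ) : Isometry (reflAt e μ) :=
  Isometry.of_dist_eq (dist_reflAt he)

lemma measurableEmbedding_reflAt (he : ‖e‖ = 1) (μ : ℝ) : MeasurableEmbedding (reflAt e μ) :=
  (isometry_reflAt he μ).isClosedEmbedding.measurableEmbedding

lemma measurePreserving_reflAt (he : ‖e‖ = 1) (μ : ℝ) : MeasurePreserving (reflAt e μ) := by
  have h := (measurePreserving_add_right (volume : Measure (Rd d)) ((2 * μ) • e)).comp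
    (reflLin e).measurePreserving
  have : reflAt e μ = (fun z : Rd d => z + (2 * μ) • e) ∘ reflLin e := by
    ext1 z
    simp only [Function.comp_apply, reflLin_apply he]
    unfold reflAt
    module
  rwa [this]

lemma norm_reflAt_sq (he : ‖e‖ = 1) (ρ : ℝ) (z : Rd d) :
    ‖reflAt e ρ z‖ ^ 2 = ‖z‖ ^ 2 + 4 * ρ * (ρ - ⟪z, e⟫) := by
  unfold reflAt
  rw [norm_sub_sq_real, real_inner_smul_right, norm_smul, he, mul_one, Real.norm_eq_abs, sq_abs]
  ring

lemma norm_lt_norm_reflAt (he : ‖e‖ = 1) {ρ : ℝ} (hρ : 0 < ρ) {z : Rd d} (hz : ⟪z, e⟫ < ρ) :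
    ‖z‖ < ‖reflAt e ρ z‖ := by
  refine lt_of_pow_lt_pow_left₀ 2 (norm_nonneg _) ?_
  rw [norm_reflAt_sq he]
  have := mul_pos hρ (sub_pos.2 hz)
  linarith

lemma lt_norm_reflAt (he : ‖e‖ = 1) {ρ : ℝ} {z : Rd d} (hz : ⟪z, e⟫ < ρ) :
    ρ < ‖reflAt e ρ z‖ :=
  PsiSetting.lt_norm_of_lt_inner he (by rw [inner_reflAt he]; linarith)

lemma reflAt_add_eq (x z : Rd d) (μ : ℝ) :
    reflAt e μ (x + z) = x + reflAt e (μ - ⟪x, e⟫) z := by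
  unfold reflAt
  rw [inner_add_left]
  module

end ReflectionMeasure

namespace PsiSetting

variable {d : ℕ} (S : PsiSetting d) {w : Rd d → ℝ} {C : ℝ} {e : Rd d}

/-- Folding the nonlocal integral of an antisymmetric function across the hyperplane. -/
lemma setIntegral_fold_le (hd : 0 < d) (hw : Measurable w) (hC : ∀ y, |w y| ≤ C) (he : ‖e‖ = 1)
    {μ : ℝ} (hanti : ∀ x, w (reflAt e μ x) = -w x) {x₀ : Rd d} (hx₀ : ⟪x₀, e⟫ < μ)
    (hmin : ∀ x, ⟪x, e⟫ ≤ μ → w x₀ ≤ w x) {η : ℝ} (hη : 0 < η) (hηρ : η < μ - ⟪x₀, e⟫)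
    {T : Set (Rd d)} (hTρ : ∀ z ∈ T, ⟪z, e⟫ < μ - ⟪x₀, e⟫)
    (hTη : ∀ z ∈ T, η < ‖z‖) :
    (∫ z in T, (w (x₀ + z) - w x₀) * (S.j ‖z‖ - S.j ‖reflAt e (μ - ⟪x₀, e⟫) z‖)) -
        2 * w x₀ * S.tailMass e (μ - ⟪x₀, e⟫) ≤
      -(∫ z in {z : Rd d | η < ‖z‖}, (w x₀ - w (x₀ + z)) * S.j ‖z‖) +
        2 * C * S.j (μ - ⟪x₀, e⟫) * volume.real (closedBall (0 : Rd d) η) := by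
  set ρ := μ - ⟪x₀, e⟫ with hρdef
  have hρ : 0 < ρ := sub_pos.2 hx₀
  have hwm : Measurable fun z : Rd d => w (x₀ + z) := hw.comp (by fun_prop)
  have hpm : Measurable fun z : Rd d => w (x₀ + z) - w x₀ := hwm.sub_const _
  have hpC : ∀ z, |w (x₀ + z) - w x₀| ≤ 2 * C := fun z => by
    have h1 := abs_le.1 (hC (x₀ + z))
    have h2 := abs_le.1 (hC x₀)
    rw [abs_le]
    constructor <;> linarith
  have hp0 : ∀ z : Rd d, ⟪z, e⟫ ≤ ρ → 0 ≤ w (x₀ + z) - w x₀ := fun z hz => by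
    refine sub_nonneg.2 (hmin _ ?_)
    rw [inner_add_left]
    linarith
  have hpτ : ∀ z : Rd d, w (x₀ + reflAt e ρ z) = -w (x₀ + z) := fun z => by
    rw [← hanti, reflAt_add_eq]
  have hτm : Measurable fun z : Rd d => S.j ‖reflAt e ρ z‖ :=
    S.measurable_j_norm.comp (measurePreserving_reflAt he ρ).measurable
  have hpre : reflAt e ρ ⁻¹' {z : Rd d | ρ < ⟪z, e⟫} = {z : Rd d | ⟪z, e⟫ < ρ} := by
    ext z
    simp only [mem_preimage, Set.mem_ofPred_eq, inner_reflAt he]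
    constructor <;> intro h <;> linarith
  have hPm : MeasurableSet {z : Rd d | ⟪z, e⟫ < ρ} := by
    rw [← hpre]
    exact (measurePreserving_reflAt he ρ).measurable (measurableSet_halfSpace e ρ)
  have hjτ : IntegrableOn (fun z : Rd d => S.j ‖reflAt e ρ z‖) {z : Rd d | ⟪z, e⟫ < ρ} := by
    rw [← hpre]
    exact ((measurePreserving_reflAt he ρ).integrableOn_comp_preimage
      (measurableEmbedding_reflAt he ρ)).2 (S.integrableOn_j_halfSpace he hρ)
  have hpjτ : IntegrableOn (fun z : Rd d => (w (x₀ + z) - w x₀) * S.j ‖reflAt e ρ z‖)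
      {z : Rd d | ⟪z, e⟫ < ρ} := by
    refine Integrable.mono' (hjτ.const_mul (2 * C)) (hpm.mul hτm).aestronglyMeasurable
      (ae_of_all _ fun z => ?_)
    rw [norm_mul, Real.norm_of_nonneg (S.j_nonneg _)]
    exact mul_le_mul_of_nonneg_right (hpC z) (S.j_nonneg _)
  have hpj : IntegrableOn (fun z : Rd d => (w (x₀ + z) - w x₀) * S.j ‖z‖) {z | η < ‖z‖} :=
    S.integrableOn_bdd_mul_j (S.integrableOn_j hη) (measurableSet_lt_norm η) hpm fun z _ => hpC z
  have hfar : (∫ z in {z : Rd d | ρ < ⟪z, e⟫}, (w (x₀ + z) - w x₀) * S.j ‖z‖) =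
      -2 * w x₀ * S.tailMass e ρ -
        ∫ z in {z : Rd d | ⟪z, e⟫ < ρ}, (w (x₀ + z) - w x₀) * S.j ‖reflAt e ρ z‖ := by
    have htail : S.tailMass e ρ = ∫ z in {z : Rd d | ⟪z, e⟫ < ρ}, S.j ‖reflAt e ρ z‖ := by
      rw [← hpre, (measurePreserving_reflAt he ρ).setIntegral_preimage_emb
        (measurableEmbedding_reflAt he ρ) (fun z : Rd d => S.j ‖z‖)]
      rfl
    rw [← (measurePreserving_reflAt he ρ).setIntegral_preimage_emb
      (measurableEmbedding_reflAt he ρ), hpre, htail, ← integral_const_mul,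
      ← integral_sub (hjτ.const_mul _) hpjτ]
    refine integral_congr_ae (ae_of_all _ fun z => ?_)
    simp only [hpτ]
    ring
  have hsplit : (∫ z in {z : Rd d | η < ‖z‖}, (w (x₀ + z) - w x₀) * S.j ‖z‖) =
      (∫ z in {z : Rd d | η < ‖z‖} \ {z | ρ < ⟪z, e⟫}, (w (x₀ + z) - w x₀) * S.j ‖z‖) +
        ∫ z in {z : Rd d | ρ < ⟪z, e⟫}, (w (x₀ + z) - w x₀) * S.j ‖z‖ := by
    have hsub : {z : Rd d | ρ < ⟪z, e⟫} ⊆ {z : Rd d | η < ‖z‖} := fun z hz =>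
      hηρ.trans (lt_norm_of_lt_inner he hz)
    rw [← setIntegral_union disjoint_sdiff_left (measurableSet_halfSpace e ρ)
      (hpj.mono_set sdiff_subset) (hpj.mono_set hsub), sdiff_union_of_subset hsub]
  set Q : Set (Rd d) := {z : Rd d | η < ‖z‖} ∩ {z | ⟪z, e⟫ < ρ} with hQ
  have hQm : MeasurableSet Q := (measurableSet_lt_norm η).inter hPm
  have hnear : (∫ z in Q, (w (x₀ + z) - w x₀) * S.j ‖z‖) ≤
      ∫ z in {z : Rd d | η < ‖z‖} \ {z | ρ < ⟪z, e⟫}, (w (x₀ + z) - w x₀) * S.j ‖z‖ := by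
    refine setIntegral_mono_set (hpj.mono_set sdiff_subset) ?_
      (Eventually.of_forall fun z hz => ⟨hz.1, lt_asymm (mem_ofPred_eq.mp hz.2)⟩)
    refine (ae_restrict_iff' ((measurableSet_lt_norm η).diff
      (measurableSet_halfSpace e ρ))).2 (ae_of_all _ fun z hz => ?_)
    exact mul_nonneg (hp0 z (not_lt.1 hz.2)) (S.j_nonneg _)
  have hsmall : (∫ z in {z : Rd d | ⟪z, e⟫ < ρ}, (w (x₀ + z) - w x₀) * S.j ‖reflAt e ρ z‖) ≤
      (∫ z in Q, (w (x₀ + z) - w x₀) * S.j ‖reflAt e ρ z‖) +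
        2 * C * S.j ρ * volume.real (closedBall (0 : Rd d) η) := by
    have hunion : {z : Rd d | ⟪z, e⟫ < ρ} = Q ∪ {z : Rd d | ⟪z, e⟫ < ρ} ∩ {z | ‖z‖ ≤ η} := by
      ext z
      simp only [hQ, Set.mem_union, mem_inter_iff, Set.mem_ofPred_eq]
      constructor
      · intro h
        rcases lt_or_ge η ‖z‖ with h' | h'
        · exact Or.inl ⟨h', h⟩
        · exact Or.inr ⟨h, h'⟩
      · rintro (h | h)
        · exact h.2
        · exact h.1
    have hm2 : MeasurableSet ({z : Rd d | ⟪z, e⟫ < ρ} ∩ {z | ‖z‖ ≤ η}) :=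
      hPm.inter (measurableSet_norm_le η)
    have hball : {z : Rd d | ‖z‖ ≤ η} = closedBall (0 : Rd d) η := by
      ext z
      simp
    have hfin : volume ({z : Rd d | ⟪z, e⟫ < ρ} ∩ {z | ‖z‖ ≤ η}) < ⊤ :=
      (measure_mono inter_subset_right).trans_lt (by rw [hball]; exact measure_closedBall_lt_top)
    rw [show (∫ z in {z : Rd d | ⟪z, e⟫ < ρ}, (w (x₀ + z) - w x₀) * S.j ‖reflAt e ρ z‖) =
        ∫ z in Q ∪ {z : Rd d | ⟪z, e⟫ < ρ} ∩ {z | ‖z‖ ≤ η},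
          (w (x₀ + z) - w x₀) * S.j ‖reflAt e ρ z‖ by rw [← hunion],
      setIntegral_union ?_ hm2 (hpjτ.mono_set inter_subset_right)
        (hpjτ.mono_set inter_subset_left)]
    · gcongr
      have hC0 : 0 ≤ 2 * C := (abs_nonneg _).trans (hpC 0)
      refine (setIntegral_mono_on (hpjτ.mono_set inter_subset_left)
        (integrableOn_const (C := 2 * C * S.j ρ) hfin.ne) hm2 fun z hz => ?_).trans ?_
      · refine mul_le_mul ((le_abs_self _).trans (hpC z)) ?_ (S.j_nonneg _) hC0
        have hlt := lt_norm_reflAt he hz.1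
        exact (S.j_strictAnti hd hρ (hρ.trans hlt) hlt).le
      · rw [setIntegral_const, smul_eq_mul, mul_comm]
        refine mul_le_mul_of_nonneg_left ?_ (mul_nonneg hC0 (S.j_nonneg _))
        refine measureReal_mono ?_ measure_closedBall_lt_top.ne
        rw [← hball]
        exact inter_subset_right
    · exact disjoint_left.2 fun z hz hz' =>
        not_lt.2 (mem_ofPred_eq.mp hz'.2) (mem_ofPred_eq.mp hz.1)
  have hmain : (∫ z in T, (w (x₀ + z) - w x₀) * (S.j ‖z‖ - S.j ‖reflAt e ρ z‖)) ≤
      (∫ z in Q, (w (x₀ + z) - w x₀) * S.j ‖z‖) -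
        ∫ z in Q, (w (x₀ + z) - w x₀) * S.j ‖reflAt e ρ z‖ := by
    have hI1 := hpj.mono_set (inter_subset_left : Q ⊆ _)
    have hI2 := hpjτ.mono_set (inter_subset_right : Q ⊆ _)
    rw [← integral_sub hI1 hI2]
    have heq : ∀ z : Rd d, (w (x₀ + z) - w x₀) * S.j ‖z‖ -
        (w (x₀ + z) - w x₀) * S.j ‖reflAt e ρ z‖ =
        (w (x₀ + z) - w x₀) * (S.j ‖z‖ - S.j ‖reflAt e ρ z‖) := fun z => by ring
    have hI := hI1.sub hI2
    simp only [Pi.sub_def, heq] at hI ⊢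
    refine setIntegral_mono_set hI ?_ (Eventually.of_forall fun z hz => ⟨hTη z hz, hTρ z hz⟩)
    refine (ae_restrict_iff' hQm).2 (ae_of_all _ fun z hz => ?_)
    refine mul_nonneg (hp0 z (le_of_lt hz.2)) (sub_nonneg.2 ?_)
    have hz0 : 0 < ‖z‖ := hη.trans hz.1
    have hlt := norm_lt_norm_reflAt he hρ hz.2
    exact (S.j_strictAnti hd hz0 (hz0.trans hlt) hlt).le
  have hneg : -(∫ z in {z : Rd d | η < ‖z‖}, (w x₀ - w (x₀ + z)) * S.j ‖z‖) =
      ∫ z in {z : Rd d | η < ‖z‖}, (w (x₀ + z) - w x₀) * S.j ‖z‖ := by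
    rw [← integral_neg]
    refine integral_congr_ae (ae_of_all _ fun z => ?_)
    ring
  rw [hneg]
  linarith

end PsiSetting

namespace PsiSetting

variable {d : ℕ} (S : PsiSetting d) {u : Rd d → ℝ} {B : ℝ}

lemma tendsto_volume_closedBall (hd : 0 < d) :
    Tendsto (fun η : ℝ => volume.real (closedBall (0 : Rd d) η)) (𝓝[>] 0) (𝓝 0) := by
  have h : Tendsto (fun η : ℝ => η ^ d * volume.real (ball (0 : Rd d) 1)) (𝓝[>] 0)
      (𝓝 (0 ^ d * volume.real (ball (0 : Rd d) 1))) :=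
    (((continuous_pow d).tendsto 0).mono_left nhdsWithin_le_nhds).mul_const _
  rw [zero_pow hd.ne', zero_mul] at h
  refine h.congr' ?_
  filter_upwards [self_mem_nhdsWithin] with η hη
  rw [Measure.addHaar_real_closedBall _ _ (le_of_lt hη), finrank_euclideanSpace_fin]

/-- The quantitative maximum principle at a nonpositive minimum point `x₀` of `u - u ∘ R` over
a half-space. -/
lemma maximum_principle_antisymm (hd : 0 < d) (hu : UniformContinuous u) (hB : ∀ y, |u y| ≤ B)
    {e : Rd d} (he : ‖e‖ = 1) {μ : ℝ} {x₀ : Rd d} (hx₀ : ⟪x₀, e⟫ < μ) {g : Rd d → ℝ}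
    (hg : Continuous g)
    (hsup : ∀ᶠ x in 𝓝 x₀, ∀ φ : Rd d → ℝ, TestAt x φ → φ x = u x →
      (∀ y, y ≠ x → φ y < u y) → g x ≤ psiOp S φ x)
    (hsub : ∀ᶠ y in 𝓝 (reflAt e μ x₀), ∀ φ : Rd d → ℝ, TestAt y φ → φ y = u y →
      (∀ x, x ≠ y → u x < φ x) → psiOp S φ y ≤ g y)
    (hmin : ∀ x, ⟪x, e⟫ ≤ μ → u x₀ - u (reflAt e μ x₀) ≤ u x - u (reflAt e μ x))
    {T : Set (Rd d)} (hTρ : ∀ z ∈ T, ⟪z, e⟫ < μ - ⟪x₀, e⟫) {c : ℝ} (hc : 0 < c)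
    (hTc : ∀ z ∈ T, c < ‖z‖) :
    (∫ z in T, ((u (x₀ + z) - u (reflAt e μ (x₀ + z))) - (u x₀ - u (reflAt e μ x₀))) *
        (S.j ‖z‖ - S.j ‖reflAt e (μ - ⟪x₀, e⟫) z‖)) +
        2 * (u (reflAt e μ x₀) - u x₀) * S.tailMass e (μ - ⟪x₀, e⟫) ≤
      g (reflAt e μ x₀) - g x₀ := by
  have hRc : Continuous (reflAt e μ) := (isometry_reflAt he μ).continuous
  have hhalf : ∀ᶠ x in 𝓝 x₀, ⟪x, e⟫ ≤ μ :=
    ((continuous_id.inner continuous_const).tendsto x₀).eventually (Iic_mem_nhds hx₀)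
  obtain ⟨r, hr, hball⟩ := nhds_basis_closedBall.eventually_iff.1
    (hsup.and (((hRc.tendsto x₀).eventually hsub).and hhalf))
  have hw : Measurable fun x => u x - u (reflAt e μ x) :=
    (hu.continuous.sub (hu.continuous.comp hRc)).measurable
  have hlim : Tendsto (fun η => g (reflAt e μ x₀) - g x₀ + (S.smallMass η +
      2 * (2 * B) * S.j (μ - ⟪x₀, e⟫) * volume.real (closedBall (0 : Rd d) η))) (𝓝[>] 0)
      (𝓝 (g (reflAt e μ x₀) - g x₀ + (0 + 2 * (2 * B) * S.j (μ - ⟪x₀, e⟫) * 0))) :=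
    (S.tendsto_smallMass.add ((tendsto_volume_closedBall hd).const_mul _)).const_add _
  rw [mul_zero, add_zero, add_zero] at hlim
  refine ge_of_tendsto hlim ?_
  filter_upwards [Ioo_mem_nhdsGT (lt_min (lt_min (half_pos hr) one_pos)
    (lt_min (sub_pos.2 hx₀) hc))] with η hη
  have h1 := S.sub_le_integral_antisymm hu hB he hg hr (fun x hx => (hball hx).1)
    (fun x hx => (hball hx).2.1) (fun x hx => hmin x (hball hx).2.2) hη.1
    (hη.2.le.trans ((min_le_left _ _).trans (min_le_left _ _)))
    (hη.2.le.trans ((min_le_left _ _).trans (min_le_right _ _)))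
  have h2 := S.setIntegral_fold_le hd hw (C := 2 * B) (fun y => ?_) he (μ := μ) (fun x => ?_) hx₀
    hmin hη.1 (hη.2.trans_le ((min_le_right _ _).trans (min_le_left _ _))) hTρ
    fun z hz => (hη.2.trans_le ((min_le_right _ _).trans (min_le_right _ _))).trans (hTc z hz)
  · linarith
  · have h3 := abs_le.1 (hB y)
    have h4 := abs_le.1 (hB (reflAt e μ y))
    rw [abs_le]
    constructor <;> linarith
  · rw [reflAt_reflAt he]
    ring

end PsiSetting

section Geometry

variable {d : ℕ} {G : Set (Rd d)} {e : Rd d}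

lemma HasC2BoundaryClosed.iUnion {n : ℕ} {G : Fin n → Set (Rd d)} (hGc : ∀ k, IsCompact (G k))
    (hGC2 : ∀ k, HasC2BoundaryClosed (G k)) (hGdisj : ∀ k l, k ≠ l → Disjoint (G k) (G l)) :
    HasC2BoundaryClosed (⋃ k, G k) := by
  intro x hx
  have hcl : IsClosed (⋃ k, G k) := isClosed_iUnion_of_finite fun k => (hGc k).isClosed
  rw [hcl.frontier_eq] at hx
  obtain ⟨k, hk⟩ := mem_iUnion.1 hx.1
  have hxk : x ∈ frontier (G k) := by
    rw [(hGc k).isClosed.frontier_eq]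
    exact ⟨hk, fun h => hx.2 (interior_mono (subset_iUnion G k) h)⟩
  obtain ⟨U, f, hU, hxU, hf, hf', hGU⟩ := hGC2 k x hxk
  have hother : IsClosed (⋃ l : {l : Fin n // l ≠ k}, G l) :=
    isClosed_iUnion_of_finite fun l => (hGc l).isClosed
  refine ⟨U ∩ (⋃ l : {l : Fin n // l ≠ k}, G l)ᶜ, f, hU.inter hother.isOpen_compl, ⟨hxU, ?_⟩,
    hf.mono inter_subset_left, fun y hy => hf' y hy.1, ?_⟩
  · intro h
    obtain ⟨l, hl⟩ := mem_iUnion.1 h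
    exact disjoint_left.1 (hGdisj l k l.2) hl hk
  · ext y
    have hy : y ∈ U → (y ∈ G k ↔ f y ≤ 0) := fun hyU => by
      have := Set.ext_iff.1 hGU y
      simpa [hyU] using this
    constructor
    · rintro ⟨hyG, hyU, hyo⟩
      obtain ⟨l, hl⟩ := mem_iUnion.1 hyG
      have hlk : l = k := by
        by_contra hne
        exact hyo (mem_iUnion.2 ⟨⟨l, hne⟩, hl⟩)
      exact ⟨⟨hyU, hyo⟩, (hy hyU).1 (hlk ▸ hl)⟩
    · rintro ⟨⟨hyU, hyo⟩, hfy⟩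
      exact ⟨mem_iUnion.2 ⟨k, (hy hyU).2 hfy⟩, hyU, hyo⟩

/-- If the local defining function increases in the direction `v` at a boundary point, then moving
backwards along `v` from points of `G` leads into the interior. -/
lemma exists_ball_mem_interior {U : Set (Rd d)} {f : Rd d → ℝ} {p v : Rd d} (hU : IsOpen U)
    (hp : p ∈ U) (hf : ContDiffOn ℝ 2 f U) (hGU : G ∩ U = {y ∈ U | f y ≤ 0})
    (hv : 0 < fderiv ℝ f p v) :
    ∃ δ > 0, ∀ x ∈ ball p δ, ∀ t > (0 : ℝ), x + t • v ∈ ball p δ → x + t • v ∈ G →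
      x ∈ interior G := by
  have hc : ContinuousOn (fun y => fderiv ℝ f y v) U :=
    (hf.continuousOn_fderiv_of_isOpen hU (by norm_num)).clm_apply continuousOn_const
  have hev : ∀ᶠ y in 𝓝 p, 0 < fderiv ℝ f y v :=
    (hc.continuousAt (hU.mem_nhds hp)).eventually (lt_mem_nhds hv)
  obtain ⟨δ, hδ, hball⟩ := nhds_basis_ball.eventually_iff.1 (hev.and (hU.mem_nhds hp))
  refine ⟨δ, hδ, fun x hx t ht hxt hxG => ?_⟩
  have hxU := (hball hx).2
  obtain ⟨z, hz, hfz⟩ := domain_mvt (f := f) (f' := fun y => fderiv ℝ f y) (s := ball p δ)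
    (fun y hy => ((hf.differentiableOn (by norm_num)).differentiableAt
      (hU.mem_nhds (hball hy).2)).hasFDerivAt.hasFDerivWithinAt) (convex_ball p δ) hx hxt
  have hzb := (convex_ball p δ).segment_subset hx hxt hz
  rw [add_sub_cancel_left, map_smul, smul_eq_mul] at hfz
  have hpos := mul_pos ht (hball hzb).1
  have hle : f (x + t • v) ≤ 0 :=
    ((Set.ext_iff.1 hGU _).1 ⟨hxG, (hball hxt).2⟩).2
  have hneg : f x < 0 := by linarith
  have hfc := hf.continuousOn.continuousAt (hU.mem_nhds hxU)
  rw [mem_interior_iff_mem_nhds]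
  filter_upwards [hfc.eventually (gt_mem_nhds hneg), hU.mem_nhds hxU] with y hy hyU
  exact ((Set.ext_iff.1 hGU y).2 ⟨hyU, le_of_lt hy⟩).1

lemma exists_ball_of_not_orthAt (hC2 : HasC2BoundaryClosed G) {p : Rd d} (hp : p ∈ frontier G)
    (hort : ¬OrthAt G e p) :
    (∃ δ > 0, ∀ x ∈ ball p δ, ∀ t > (0 : ℝ), x + t • e ∈ ball p δ → x + t • e ∈ G →
      x ∈ interior G) ∨
    ∃ δ > 0, ∀ x ∈ ball p δ, ∀ t > (0 : ℝ), x + t • e ∈ ball p δ → x ∈ G →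
      x + t • e ∈ interior G := by
  obtain ⟨U, f, hU, hpU, hf, hf', hGU⟩ := hC2 p hp
  have hne : fderiv ℝ f p e ≠ 0 := fun h => hort ⟨U, f, hU, hpU, hf, hf' p hpU, hGU, h⟩
  rcases hne.lt_or_gt with h | h
  · right
    obtain ⟨δ, hδ, H⟩ := exists_ball_mem_interior (v := -e) hU hpU hf hGU
      (by rw [map_neg]; linarith)
    refine ⟨δ, hδ, fun x hx t ht hxt hxG => ?_⟩
    have hback : x + t • e + t • (-e) = x := by module
    exact H _ hxt t ht (by rwa [hback]) (by rwa [hback])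
  · exact Or.inl (exists_ball_mem_interior hU hpU hf hGU h)

lemma eventually_add_smul_mem {x : Rd d} {U : Set (Rd d)} (hU : U ∈ 𝓝 x) (v : Rd d) :
    ∀ᶠ s : ℝ in 𝓝[>] 0, x + s • v ∈ U := by
  have : Tendsto (fun s : ℝ => x + s • v) (𝓝 0) (𝓝 (x + (0 : ℝ) • v)) :=
    Continuous.tendsto (by fun_prop) 0
  rw [zero_smul, add_zero] at this
  exact (this.mono_left nhdsWithin_le_nhds).eventually hU

lemma inner_add_smul_self (he : ‖e‖ = 1) (x : Rd d) (s : ℝ) : ⟪x + s • e, e⟫ = ⟪x, e⟫ + s := by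
  rw [inner_add_left, real_inner_smul_left, real_inner_self_eq_norm_sq, he]
  ring

/-- Past the last critical position, reflected caps lie in the interior of `G`. -/
lemma reflAt_mem_interior (hGc : IsCompact G) (hC2 : HasC2BoundaryClosed G) (he : ‖e‖ = 1)
    {lam₀ : ℝ} (hno : ∀ ν > lam₀, ¬Sit1 G e ν ∧ ¬Sit2 G e ν) {ν : ℝ} (hν : lam₀ < ν) {x : Rd d}
    (hx : x ∈ G) (hxν : ν < ⟪x, e⟫) : reflAt e ν x ∈ interior G := by
  by_contra hbad
  set Bd : Set ℝ := {ν | lam₀ < ν ∧ ∃ x ∈ G, ν < ⟪x, e⟫ ∧ reflAt e ν x ∉ interior G} with hBd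
  have hne : Bd.Nonempty := ⟨ν, hν, x, hx, hxν, hbad⟩
  have hbdd : BddAbove Bd := by
    obtain ⟨C, hC⟩ := (hGc.image (f := fun x : Rd d => (⟪x, e⟫ : ℝ)) (by fun_prop)).bddAbove
    refine ⟨C, ?_⟩
    rintro t ⟨-, y, hy, hty, -⟩
    exact hty.le.trans (hC (mem_image_of_mem _ hy))
  have hν₁ : lam₀ < sSup Bd := hν.trans_le (le_csSup hbdd ⟨hν, x, hx, hxν, hbad⟩)
  obtain ⟨t, -, htlim, htB⟩ := exists_seq_tendsto_sSup hne hbdd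
  set ν₁ := sSup Bd with hν₁def
  have hgood : ∀ s > ν₁, ∀ y ∈ G, s < ⟪y, e⟫ → reflAt e s y ∈ interior G := by
    intro s hs y hy hsy
    by_contra h
    exact not_le.2 hs (le_csSup hbdd ⟨hν₁.trans hs, y, hy, hsy, h⟩)
  choose ht y hyG hty hyint using htB
  obtain ⟨x₁, hx₁, φ, hφ, hφlim⟩ := hGc.tendsto_subseq hyG
  have htφ : Tendsto (t ∘ φ) atTop (𝓝 ν₁) := htlim.comp hφ.tendsto_atTop
  have hRlim : Tendsto (fun k => reflAt e (t (φ k)) (y (φ k))) atTop (𝓝 (reflAt e ν₁ x₁)) :=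
    (continuous_reflAt.tendsto (ν₁, x₁)).comp (htφ.prodMk_nhds hφlim)
  have hRx₁ : reflAt e ν₁ x₁ ∉ interior G :=
    isOpen_interior.isClosed_compl.mem_of_tendsto hRlim (Eventually.of_forall fun k => hyint (φ k))
  have hx₁ν : ν₁ ≤ ⟪x₁, e⟫ :=
    le_of_tendsto_of_tendsto' htφ (((continuous_id.inner continuous_const).tendsto x₁).comp hφlim)
      fun k => (hty (φ k)).le
  rcases hx₁ν.lt_or_eq with hlt | heq
  · have hx₁i : x₁ ∉ interior G := by
      intro h
      obtain ⟨s, hs, hs0⟩ := ((eventually_add_smul_mem (mem_interior_iff_mem_nhds.1 h)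
        ((2 : ℝ) • e)).and self_mem_nhdsWithin).exists
      have hs0' : (0 : ℝ) < s := hs0
      have h2 : x₁ + s • (2 : ℝ) • e = x₁ + (2 * s) • e := by module
      rw [h2] at hs
      have h3 := inner_add_smul_self he x₁ (2 * s)
      refine hRx₁ ?_
      have h4 := hgood (ν₁ + s) (by linarith) _ hs (by linarith)
      have h5 : reflAt e (ν₁ + s) (x₁ + (2 * s) • e) = reflAt e ν₁ x₁ := by
        rw [reflAt, h3, reflAt]
        module
      rwa [h5] at h4
    have hRG : reflAt e ν₁ x₁ ∈ G := by
      have hlim : Tendsto (fun s => reflAt e s x₁) (𝓝[>] ν₁) (𝓝 (reflAt e ν₁ x₁)) :=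
        ((continuous_reflAt.comp (by fun_prop : Continuous fun s : ℝ => (s, x₁))).tendsto
          ν₁).mono_left nhdsWithin_le_nhds
      refine hGc.isClosed.mem_of_tendsto hlim ?_
      filter_upwards [Ioo_mem_nhdsGT hlt] with s hs
      exact interior_subset (hgood s hs.1 x₁ hx₁ hs.2)
    refine (hno ν₁ hν₁).1 ⟨reflAt e ν₁ x₁, ?_, ?_, ?_⟩
    · rw [hGc.isClosed.frontier_eq]
      exact ⟨hRG, hRx₁⟩
    · refine ⟨subset_closure (mem_image_of_mem _ ⟨hx₁, hlt⟩), fun hInt => hx₁i ?_⟩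
      have hop : IsOpen (reflAt e ν₁ ⁻¹' interior (reflAt e ν₁ '' (G ∩ halfSpace e ν₁))) :=
        isOpen_interior.preimage (isometry_reflAt he ν₁).continuous
      refine interior_maximal (fun z hz => ?_) hop hInt
      obtain ⟨z', hz', hzz'⟩ := interior_subset hz
      have : z' = z := (isometry_reflAt he ν₁).injective hzz'
      exact this ▸ hz'.1
    · rw [inner_reflAt he]
      intro h
      linarith
  · rw [reflAt_of_inner_eq heq.symm] at hRx₁ hRlim
    have hfr : x₁ ∈ frontier G := by
      rw [hGc.isClosed.frontier_eq]
      exact ⟨hx₁, hRx₁⟩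
    rcases exists_ball_of_not_orthAt hC2 hfr fun h => (hno ν₁ hν₁).2 ⟨x₁, hfr, heq.symm, h⟩ with
      ⟨δ, hδ, H⟩ | ⟨δ, hδ, H⟩
    · obtain ⟨k, hk1, hk2⟩ := ((hRlim.eventually (ball_mem_nhds x₁ hδ)).and
        (hφlim.eventually (ball_mem_nhds x₁ hδ))).exists
      have hk : reflAt e (t (φ k)) (y (φ k)) +
          (2 * (⟪y (φ k), e⟫ - t (φ k))) • e = y (φ k) := by
        unfold reflAt
        module
      refine hyint (φ k) (H _ hk1 (2 * (⟪y (φ k), e⟫ - t (φ k))) ?_ ?_ ?_)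
      · linarith [hty (φ k)]
      · rw [hk]
        exact hk2
      · rw [hk]
        exact hyG _
    · obtain ⟨s, ⟨hs1, hs2⟩, hs0⟩ := (((eventually_add_smul_mem (ball_mem_nhds x₁ hδ)
        ((3 : ℝ) • e)).and (eventually_add_smul_mem (ball_mem_nhds x₁ hδ) (-e))).and
        self_mem_nhdsWithin).exists
      have hs0' : (0 : ℝ) < s := hs0
      have h3 : x₁ + s • (3 : ℝ) • e = x₁ + (3 * s) • e := by module
      rw [h3] at hs1
      have h4 := inner_add_smul_self he x₁ (3 * s)
      have hmem := H x₁ (mem_ball_self hδ) (3 * s) (by linarith) hs1 hx₁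
      have h5 := hgood (ν₁ + s) (by linarith) _ (interior_subset hmem) (by linarith)
      have h6 : reflAt e (ν₁ + s) (x₁ + (3 * s) • e) = x₁ + s • (-e) := by
        rw [reflAt, h4, heq]
        module
      rw [h6] at h5
      have h7 : x₁ + s • (-e) + s • e = x₁ := by module
      have h8 := H _ hs2 s hs0' (by rw [h7]; exact mem_ball_self hδ) (interior_subset h5)
      rw [h7] at h8
      exact hRx₁ h8

/-- Past the last critical position, `G` is not symmetric. -/
lemma exists_reflAt_notMem (hGc : IsCompact G) (hC2 : HasC2BoundaryClosed G) (hne : G.Nonempty)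
    (he : ‖e‖ = 1) {lam₀ : ℝ} (hno : ∀ ν > lam₀, ¬Sit1 G e ν ∧ ¬Sit2 G e ν) {ν : ℝ}
    (hν : lam₀ < ν) : ∃ x ∈ G, reflAt e ν x ∉ G := by
  by_contra! hsym
  obtain ⟨x, hx, hmax⟩ := hGc.exists_isMaxOn hne
    (f := fun x : Rd d => (⟪x, e⟫ : ℝ)) (by fun_prop)
  have hxi : x ∉ interior G := by
    intro h
    obtain ⟨s, hs, hs0⟩ := ((eventually_add_smul_mem (mem_interior_iff_mem_nhds.1 h) e).and
      self_mem_nhdsWithin).exists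
    have hs0' : (0 : ℝ) < s := hs0
    have h1 : (⟪x + s • e, e⟫ : ℝ) ≤ ⟪x, e⟫ := hmax hs
    rw [inner_add_smul_self he] at h1
    linarith
  rcases lt_or_ge ν ⟪x, e⟫ with hlt | hle
  · have h1 := reflAt_mem_interior hGc hC2 he hno hν hx hlt
    have hop : IsOpen (reflAt e ν ⁻¹' interior G) :=
      isOpen_interior.preimage (isometry_reflAt he ν).continuous
    refine hxi (interior_maximal (fun z hz => ?_) hop h1)
    rw [← reflAt_reflAt (μ := ν) he z]
    exact hsym _ (interior_subset hz)
  · have hplane : ∀ y ∈ G, ⟪y, e⟫ = ν := by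
      intro y hy
      have h1 : (⟪y, e⟫ : ℝ) ≤ ⟪x, e⟫ := hmax hy
      have h2 : (⟪reflAt e ν y, e⟫ : ℝ) ≤ ⟪x, e⟫ := hmax (hsym y hy)
      rw [inner_reflAt he] at h2
      linarith
    have hfr : x ∈ frontier G := by
      rw [hGc.isClosed.frontier_eq]
      exact ⟨hx, hxi⟩
    rcases exists_ball_of_not_orthAt hC2 hfr fun h => (hno ν hν).2 ⟨x, hfr, hplane x hx, h⟩ with
      ⟨δ, hδ, H⟩ | ⟨δ, hδ, H⟩
    · obtain ⟨s, hs, hs0⟩ := ((eventually_add_smul_mem (ball_mem_nhds x hδ) (-e)).and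
        self_mem_nhdsWithin).exists
      have hs0' : (0 : ℝ) < s := hs0
      have h7 : x + s • (-e) + s • e = x := by module
      have h8 := H _ hs s hs0' (by rw [h7]; exact mem_ball_self hδ) (by rwa [h7])
      have h9 := hplane _ (interior_subset h8)
      have h10 := inner_add_smul_self he (x + s • (-e)) s
      rw [h7, hplane x hx] at h10
      linarith
    · obtain ⟨s, hs, hs0⟩ := ((eventually_add_smul_mem (ball_mem_nhds x hδ) e).and
        self_mem_nhdsWithin).exists
      have hs0' : (0 : ℝ) < s := hs0
      have h9 := hplane _ (interior_subset (H x (mem_ball_self hδ) s hs0' hs hx))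
      rw [inner_add_smul_self he, hplane x hx] at h9
      linarith

end Geometry

/-- A negative value of `u - u ∘ R` over a half-space forces an attained negative minimum. -/
lemma exists_negative_minimum {d : ℕ} {u : Rd d → ℝ} (hu : Continuous u)
    (hdecay : Tendsto u (cocompact (Rd d)) (𝓝 0)) {e : Rd d} (he : ‖e‖ = 1) {μ : ℝ} {x₁ : Rd d}
    (hx₁ : ⟪x₁, e⟫ < μ) (hneg : u x₁ - u (reflAt e μ x₁) < 0) :
    ∃ x₀, ⟪x₀, e⟫ < μ ∧ u x₀ - u (reflAt e μ x₀) < 0 ∧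
      ∀ x, ⟪x, e⟫ ≤ μ → u x₀ - u (reflAt e μ x₀) ≤ u x - u (reflAt e μ x) := by
  have hR := isometry_reflAt he μ
  have hlim : Tendsto (fun x => u x - u (reflAt e μ x)) (cocompact (Rd d)) (𝓝 0) := by
    simpa using hdecay.sub (hdecay.comp hR.isClosedEmbedding.tendsto_cocompact)
  obtain ⟨x₀, hx₀, hmin⟩ := ContinuousOn.exists_isMinOn' (s := {x : Rd d | ⟪x, e⟫ ≤ μ})
    (hu.sub (hu.comp hR.continuous)).continuousOn
    (isClosed_le (by fun_prop) continuous_const) (le_of_lt hx₁)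
    ((hlim.eventually (lt_mem_nhds hneg)).filter_mono inf_le_left |>.mono fun x hx => le_of_lt hx)
  have hx₀neg : u x₀ - u (reflAt e μ x₀) < 0 :=
    (show u x₀ - u (reflAt e μ x₀) ≤ u x₁ - u (reflAt e μ x₁) from
      hmin (show x₁ ∈ {x : Rd d | ⟪x, e⟫ ≤ μ} from le_of_lt hx₁)).trans_lt hneg
  refine ⟨x₀, lt_of_le_of_ne hx₀ fun h => ?_, hx₀neg, fun x hx => hmin hx⟩
  rw [reflAt_of_inner_eq h, sub_self] at hx₀neg
  exact lt_irrefl _ hx₀neg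

namespace PsiSetting

variable {d : ℕ} (S : PsiSetting d) {u : Rd d → ℝ} {B : ℝ}

/-- The strong maximum principle for `u - u ∘ R`. -/
lemma eq_comp_reflAt_of_touching (hd : 0 < d) (hu : UniformContinuous u) (hB : ∀ y, |u y| ≤ B)
    {e : Rd d} (he : ‖e‖ = 1) {μ : ℝ} {x₀ : Rd d} (hx₀ : ⟪x₀, e⟫ < μ) {g : Rd d → ℝ}
    (hg : Continuous g)
    (hsup : ∀ᶠ x in 𝓝 x₀, ∀ φ : Rd d → ℝ, TestAt x φ → φ x = u x →
      (∀ y, y ≠ x → φ y < u y) → g x ≤ psiOp S φ x)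
    (hsub : ∀ᶠ y in 𝓝 (reflAt e μ x₀), ∀ φ : Rd d → ℝ, TestAt y φ → φ y = u y →
      (∀ x, x ≠ y → u x < φ x) → psiOp S φ y ≤ g y)
    (hmin : ∀ x, ⟪x, e⟫ ≤ μ → 0 ≤ u x - u (reflAt e μ x))
    (hux₀ : u (reflAt e μ x₀) = u x₀) (hgx₀ : g (reflAt e μ x₀) = g x₀) {y : Rd d}
    (hy : ⟪y, e⟫ < μ) : u (reflAt e μ y) = u y := by
  by_contra hne
  have hypos : 0 < u y - u (reflAt e μ y) := (hmin y hy.le).lt_of_ne fun h => hne (by linarith)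
  have hRc : Continuous (reflAt e μ) := (isometry_reflAt he μ).continuous
  have hwc : Continuous fun z : Rd d => u (x₀ + z) - u (reflAt e μ (x₀ + z)) :=
    (hu.continuous.comp (by fun_prop)).sub (hu.continuous.comp (hRc.comp (by fun_prop)))
  set ρ := μ - ⟪x₀, e⟫ with hρdef
  have hρ : 0 < ρ := sub_pos.2 hx₀
  have hyz : x₀ + (y - x₀) = y := add_sub_cancel _ _
  have hz₁ : 0 < ‖y - x₀‖ := by
    rw [norm_pos_iff, sub_ne_zero]
    rintro rfl
    exact hne hux₀
  have hz₁ρ : ⟪y - x₀, e⟫ < ρ := by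
    rw [inner_sub_left]
    linarith
  have hev1 : ∀ᶠ z in 𝓝 (y - x₀), 0 < u (x₀ + z) - u (reflAt e μ (x₀ + z)) :=
    (hwc.tendsto (y - x₀)).eventually (lt_mem_nhds (by rwa [hyz]))
  have hev2 : ∀ᶠ z in 𝓝 (y - x₀), ⟪z, e⟫ < ρ :=
    ((continuous_id.inner continuous_const).tendsto (y - x₀)).eventually (gt_mem_nhds hz₁ρ)
  have hev3 : ∀ᶠ z in 𝓝 (y - x₀), ‖y - x₀‖ / 2 < ‖z‖ :=
    (continuous_norm.tendsto (y - x₀)).eventually (lt_mem_nhds (half_lt_self hz₁))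
  obtain ⟨δ, hδ, hball⟩ := nhds_basis_ball.eventually_iff.1 (hev1.and (hev2.and hev3))
  have hMP := S.maximum_principle_antisymm hd hu hB he hx₀ hg hsup hsub
    (fun x hx => by rw [hux₀, sub_self]; exact hmin x hx) (T := ball (y - x₀) δ)
    (fun z hz => (hball hz).2.1) (half_pos hz₁) fun z hz => (hball hz).2.2
  rw [hux₀, hgx₀, sub_self, sub_self, mul_zero, zero_mul, add_zero, ← hρdef] at hMP
  simp only [sub_zero] at hMP
  have hjlt : ∀ z ∈ ball (y - x₀) δ, S.j ‖reflAt e ρ z‖ < S.j ‖z‖ := fun z hz => by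
    have hz0 : 0 < ‖z‖ := (half_pos hz₁).trans (hball hz).2.2
    have hlt := norm_lt_norm_reflAt he hρ (hball hz).2.1
    exact S.j_strictAnti hd hz0 (hz0.trans hlt) hlt
  have hpos : ∀ z ∈ ball (y - x₀) δ, 0 < (u (x₀ + z) - u (reflAt e μ (x₀ + z))) *
      (S.j ‖z‖ - S.j ‖reflAt e ρ z‖) := fun z hz =>
    mul_pos (hball hz).1 (sub_pos.2 (hjlt z hz))
  have hInt : IntegrableOn (fun z : Rd d => (u (x₀ + z) - u (reflAt e μ (x₀ + z))) *
      (S.j ‖z‖ - S.j ‖reflAt e ρ z‖)) (ball (y - x₀) δ) := by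
    refine Measure.integrableOn_of_bounded (M := 2 * B * S.j (‖y - x₀‖ / 2))
      measure_ball_lt_top.ne (hwc.measurable.mul (S.measurable_j_norm.sub
        (S.measurable_j_norm.comp (isometry_reflAt he ρ).continuous.measurable))).aestronglyMeasurable
      ((ae_restrict_iff' measurableSet_ball).2 (ae_of_all _ fun z hz => ?_))
    have h1 := abs_le.1 (hB (x₀ + z))
    have h2 := abs_le.1 (hB (reflAt e μ (x₀ + z)))
    have h3 := S.j_nonneg ‖reflAt e ρ z‖
    have h4 : S.j ‖z‖ ≤ S.j (‖y - x₀‖ / 2) :=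
      (S.j_strictAnti hd (half_pos hz₁) ((half_pos hz₁).trans (hball hz).2.2) (hball hz).2.2).le
    rw [Real.norm_of_nonneg (hpos z hz).le]
    refine mul_le_mul (by linarith) (by linarith) (sub_nonneg.2 (hjlt z hz).le) (by linarith)
  have h0 := (setIntegral_pos_iff_support_of_nonneg_ae
    ((ae_restrict_iff' measurableSet_ball).2 (ae_of_all _ fun z hz => (hpos z hz).le)) hInt).2
    ((measure_ball_pos volume (y - x₀) hδ).trans_le
      (measure_mono fun z hz => ⟨(hpos z hz).ne', hz⟩))
  linarith

end PsiSetting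

/-- Past the last critical position the solution dominates its reflection. -/
lemma antisymm_nonneg_of_critical_lt {d : ℕ} (hd : 2 ≤ d) (S : PsiSetting d) {G : Set (Rd d)}
    (hGc : IsCompact G) (hC2 : HasC2BoundaryClosed G) (hGne : G.Nonempty) {A : ℝ} {f : ℝ → ℝ}
    {L : ℝ≥0} (hf : LipschitzOnWith L f (Icc 0 A)) {f₀ : ℝ} (hf₀ : 0 < f₀)
    (hmono : AntitoneOn f (Icc 0 f₀)) {u : Rd d → ℝ} (hu : Continuous u)
    (hsol : IsSol S Gᶜ (fun _ => 0) (fun x => f (u x)) u) (hA : 0 < A) (hG : ∀ x ∈ G, u x = A)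
    (hbound : ∀ x ∉ G, 0 ≤ u x ∧ u x < A) (hdecay : Tendsto u (cocompact (Rd d)) (𝓝 0))
    {e : Rd d} (he : ‖e‖ = 1) {lam₀ : ℝ} (hno : ∀ ν > lam₀, ¬Sit1 G e ν ∧ ¬Sit2 G e ν)
    {μ : ℝ} (hμ : lam₀ < μ) {x : Rd d} (hx : ⟪x, e⟫ < μ) : 0 ≤ u x - u (reflAt e μ x) := by
  have hd0 : 0 < d := by omega
  have hu0 : ∀ y, u y ∈ Icc 0 A := fun y => by
    by_cases hy : y ∈ G
    · rw [hG y hy]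
      exact ⟨hA.le, le_rfl⟩
    · exact ⟨(hbound y hy).1, (hbound y hy).2.le⟩
  have hB : ∀ y, |u y| ≤ A := fun y => by
    rw [abs_of_nonneg (hu0 y).1]
    exact (hu0 y).2
  have huc : UniformContinuous u := hu.uniformContinuous_of_tendsto_cocompact hdecay
  have hg : Continuous fun y => f (u y) := hf.continuousOn.comp_continuous hu hu0
  have hGo : IsOpen Gᶜ := hGc.isClosed.isOpen_compl
  have hsup : ∀ y ∉ G, ∀ᶠ y' in 𝓝 y, ∀ φ : Rd d → ℝ, TestAt y' φ → φ y' = u y' →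
      (∀ z, z ≠ y' → φ z < u z) → f (u y') ≤ psiOp S φ y' := fun y hy => by
    filter_upwards [hGo.mem_nhds hy] with y' hy' φ h1 h2 h3
    simpa using hsol.2.2 y' hy' φ h1 h2 h3
  have hsub : ∀ y ∉ G, ∀ᶠ y' in 𝓝 y, ∀ φ : Rd d → ℝ, TestAt y' φ → φ y' = u y' →
      (∀ z, z ≠ y' → u z < φ z) → psiOp S φ y' ≤ f (u y') := fun y hy => by
    filter_upwards [hGo.mem_nhds hy] with y' hy' φ h1 h2 h3
    simpa using hsol.1.2 y' hy' φ h1 h2 h3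
  have hrefl : ∀ {ν : ℝ} {y : Rd d}, lam₀ < ν → ⟪y, e⟫ < ν → reflAt e ν y ∈ G →
      y ∈ interior G := fun {ν y} hν hy hRy => by
    have := reflAt_mem_interior hGc hC2 he hno hν hRy (by rw [inner_reflAt he]; linarith)
    rwa [reflAt_reflAt he] at this
  have hnotG : ∀ {ν : ℝ} {y : Rd d}, lam₀ < ν → ⟪y, e⟫ < ν → u y - u (reflAt e ν y) < 0 →
      y ∉ G ∧ reflAt e ν y ∉ G := fun {ν y} hν hy hneg => by
    have h1 : y ∉ G := fun h => by
      rw [hG y h] at hneg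
      linarith [(hu0 (reflAt e ν y)).2]
    exact ⟨h1, fun h => h1 (interior_subset (hrefl hν hy h))⟩
  have hdata : ∀ {ν : ℝ} {y : Rd d}, lam₀ < ν → ⟪y, e⟫ < ν → u y - u (reflAt e ν y) < 0 →
      (∀ x, ⟪x, e⟫ ≤ ν → u y - u (reflAt e ν y) ≤ u x - u (reflAt e ν x)) →
      f₀ < u (reflAt e ν y) ∧ S.tailMass e (ν - ⟪y, e⟫) ≤ L := fun {ν y} hν hy hneg hmin => by
    obtain ⟨h1, h2⟩ := hnotG hν hy hneg
    have hMP := S.maximum_principle_antisymm hd0 huc hB he hy hg (hsup y h1) (hsub _ h2) hmin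
      (T := ∅) (fun z hz => absurd hz (notMem_empty z)) one_pos
      fun z hz => absurd hz (notMem_empty z)
    rw [setIntegral_empty, zero_add] at hMP
    have hm : 0 < u (reflAt e ν y) - u y := by linarith
    have htail := S.tailMass_pos hd0 he (sub_pos.2 hy)
    constructor
    · by_contra! hle
      have := hmono ⟨(hu0 y).1, by linarith⟩ ⟨(hu0 (reflAt e ν y)).1, hle⟩
        (by linarith : u y ≤ u (reflAt e ν y))
      have := mul_pos hm htail
      linarith
    · have hL := hf.dist_le_mul _ (hu0 (reflAt e ν y)) _ (hu0 y)
      rw [Real.dist_eq, Real.dist_eq, abs_of_pos hm] at hL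
      have h3 := (le_abs_self _).trans hL
      nlinarith
  by_contra! hneg
  set Bd : Set ℝ := {ν | lam₀ < ν ∧ ∃ y, ⟪y, e⟫ < ν ∧ u y - u (reflAt e ν y) < 0 ∧
    ∀ x, ⟪x, e⟫ ≤ ν → u y - u (reflAt e ν y) ≤ u x - u (reflAt e ν x)} with hBd
  have hne : Bd.Nonempty := ⟨μ, hμ, exists_negative_minimum hu hdecay he hx hneg⟩
  obtain ⟨K, hK⟩ : ∃ K, ∀ y, f₀ < u y → ‖y‖ ≤ K := by
    have h1 : {y | u y < f₀} ∈ cocompact (Rd d) := hdecay.eventually (gt_mem_nhds hf₀)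
    obtain ⟨C, hC, hCs⟩ := mem_cocompact.1 h1
    obtain ⟨K, hK⟩ := hC.isBounded.exists_norm_le
    refine ⟨K, fun y hy => hK y ?_⟩
    by_contra h
    exact lt_asymm hy (hCs h)
  have hbdd : BddAbove Bd := by
    refine ⟨K, ?_⟩
    rintro ν ⟨hν, y, hy, hyneg, hymin⟩
    have h1 := hK _ (hdata hν hy hyneg hymin).1
    have h2 := (real_inner_le_norm (reflAt e ν y) e)
    rw [inner_reflAt he, he, mul_one] at h2
    linarith
  obtain ⟨t, -, htlim, htB⟩ := exists_seq_tendsto_sSup hne hbdd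
  have hν₁ : lam₀ < sSup Bd :=
    hμ.trans_le (le_csSup hbdd ⟨hμ, exists_negative_minimum hu hdecay he hx hneg⟩)
  set ν₁ := sSup Bd with hν₁def
  have hnn : ∀ y, ⟪y, e⟫ ≤ ν₁ → 0 ≤ u y - u (reflAt e ν₁ y) := by
    intro y hy
    rcases hy.lt_or_eq with hlt | heq
    · by_contra! h
      have hc : Continuous fun s : ℝ => u y - u (reflAt e s y) :=
        continuous_const.sub (hu.comp (continuous_reflAt.comp (by fun_prop :
          Continuous fun s : ℝ => (s, y))))
      obtain ⟨s, hs, hs1⟩ := (((hc.tendsto ν₁).mono_left nhdsWithin_le_nhds).eventually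
        (gt_mem_nhds h) |>.and (self_mem_nhdsWithin : Ioi ν₁ ∈ 𝓝[>] ν₁)).exists
      have hs1' : ν₁ < s := hs1
      exact not_le.2 hs1' (le_csSup hbdd ⟨hν₁.trans hs1',
        exists_negative_minimum hu hdecay he (hlt.trans hs1') hs⟩)
    · rw [reflAt_of_inner_eq heq, sub_self]
  choose ht y hyt hyneg hymin using htB
  have hRy : ∀ k, reflAt e (t k) (y k) ∈ closedBall (0 : Rd d) K := fun k => by
    rw [mem_closedBall_zero_iff]
    exact hK _ (hdata (ht k) (hyt k) (hyneg k) (hymin k)).1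
  obtain ⟨p, -, φ, hφ, hφlim⟩ := (isCompact_closedBall (0 : Rd d) K).tendsto_subseq hRy
  have htφ : Tendsto (fun k => t (φ k)) atTop (𝓝 ν₁) := htlim.comp hφ.tendsto_atTop
  have hylim : Tendsto (fun k => y (φ k)) atTop (𝓝 (reflAt e ν₁ p)) := by
    refine ((continuous_reflAt.tendsto (ν₁, p)).comp (htφ.prodMk_nhds hφlim)).congr fun k => ?_
    exact reflAt_reflAt he _
  set x₀ := reflAt e ν₁ p with hx₀
  have hilim : Tendsto (fun k => (⟪y (φ k), e⟫ : ℝ)) atTop (𝓝 ⟪x₀, e⟫) :=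
    ((continuous_id.inner continuous_const).tendsto x₀).comp hylim
  have hx₀ν : ⟪x₀, e⟫ ≤ ν₁ := le_of_tendsto_of_tendsto' hilim htφ fun k => (hyt (φ k)).le
  rcases hx₀ν.lt_or_eq with hlt | heq
  · have hRlim : Tendsto (fun k => reflAt e (t (φ k)) (y (φ k))) atTop (𝓝 (reflAt e ν₁ x₀)) :=
      (continuous_reflAt.tendsto (ν₁, x₀)).comp (htφ.prodMk_nhds hylim)
    have hw0 : u x₀ - u (reflAt e ν₁ x₀) ≤ 0 :=
      le_of_tendsto (((hu.tendsto _).comp hylim).sub ((hu.tendsto _).comp hRlim))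
        (Eventually.of_forall fun k => (hyneg (φ k)).le)
    have hux₀ : u (reflAt e ν₁ x₀) = u x₀ := by linarith [hnn x₀ hx₀ν]
    have hGiff : ∀ y, u y = A → y ∈ G := fun y hy => by
      by_contra h
      exact (hbound y h).2.ne hy
    have hx₀G : x₀ ∉ G := by
      intro h
      have h1 := hrefl hν₁ hlt (hGiff _ (hux₀.trans (hG x₀ h)))
      obtain ⟨k, hk⟩ := (hylim.eventually (mem_interior_iff_mem_nhds.1 h1)).exists
      exact (hnotG (ht (φ k)) (hyt (φ k)) (hyneg (φ k))).1 hk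
    have hRx₀G : reflAt e ν₁ x₀ ∉ G := fun h =>
      hx₀G (hGiff _ (hux₀.symm.trans (hG _ h)))
    have hzero := fun y (hy : ⟪y, e⟫ < ν₁) => S.eq_comp_reflAt_of_touching hd0 huc hB he hlt hg
      (hsup x₀ hx₀G) (hsub _ hRx₀G) hnn hux₀ (by simp only [hux₀]) hy
    obtain ⟨q, hq, hRq⟩ := exists_reflAt_notMem hGc hC2 hGne he hno hν₁
    refine hRq (hGiff _ ?_)
    rw [← hG q hq]
    rcases lt_trichotomy ⟪q, e⟫ ν₁ with h | h | h
    · exact hzero q h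
    · rw [reflAt_of_inner_eq h]
    · have := hzero (reflAt e ν₁ q) (by rw [inner_reflAt he]; linarith)
      rw [reflAt_reflAt he] at this
      exact this.symm
  · have hρlim : Tendsto (fun k => t (φ k) - ⟪y (φ k), e⟫) atTop (𝓝[>] 0) := by
      rw [tendsto_nhdsWithin_iff]
      refine ⟨?_, Eventually.of_forall fun k => sub_pos.2 (hyt (φ k))⟩
      have := htφ.sub hilim
      rwa [heq, sub_self] at this
    obtain ⟨k, hk⟩ := (hρlim.eventually (S.eventually_lt_tailMass hd0 he L)).exists
    exact not_le.2 hk (hdata (ht (φ k)) (hyt (φ k)) (hyneg (φ k)) (hymin (φ k))).2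

/-- **Lemma 4.4** (the critical position is the geometric one): in the setting
of Theorem 2.3, `λ* = λ₀`. -/
theorem moving_plane_critical_eq_geometric
    {d : ℕ} (hd : 2 ≤ d) (S : PsiSetting d) (hker : S.kernelCond)
    (V : ℝ → ℝ) (hV : IsRenewal S.Ψ V)
    (n : ℕ) (hn : 0 < n) (G : Fin n → Set (Rd d))
    (hGc : ∀ k, IsCompact (G k)) (hGconn : ∀ k, IsConnected (G k))
    (hGC2 : ∀ k, HasC2BoundaryClosed (G k))
    (hGdisj : ∀ k l, k ≠ l → Disjoint (G k) (G l))
    (A : ℝ) (hA : 0 < A)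
    (f : ℝ → ℝ) (hf : ∃ L : ℝ≥0, LipschitzOnWith L f (Set.Icc 0 A))
    (f₀ : ℝ) (hf₀ : 0 < f₀ ∧ f₀ ≤ A) (hmono : AntitoneOn f (Set.Icc 0 f₀))
    (Ak : Fin n → ℝ) (hAk : ∀ k, Ak k ≤ 0)
    (u : Rd d → ℝ)
    (β : ℝ) (hβ : 0 < β ∧ β < 1)
    (hHolder : ∃ C > (0:ℝ), ∀ x y, |u x - u y| ≤ C * ‖x - y‖ ^ β)
    (hsol : IsSol S ((⋃ k, G k)ᶜ) (fun _ => 0) (fun x => f (u x)) u)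
    (hG : ∀ x ∈ ⋃ k, G k, u x = A)
    (htr : ∀ k, ∀ x ∈ frontier (G k),
      HasVTrace V ((⋃ k, G k)ᶜ) (fun z => u z - A) x (Ak k))
    (hbound : ∀ x ∉ ⋃ k, G k, 0 ≤ u x ∧ u x < A)
    (hdecay : Filter.Tendsto u (Filter.cocompact (Rd d)) (nhds 0))
    (e : Rd d) (he : ‖e‖ = 1)
    (lam₀ : ℝ)
    (hlam₀ : IsGreatest
      {lam : ℝ | Sit1 (⋃ k, G k) e lam ∨ Sit2 (⋃ k, G k) e lam} lam₀)
    (lamStar : ℝ)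
    (hlamStar : lamStar = sInf {lam : ℝ | lam₀ ≤ lam ∧
      ∀ μ : ℝ, lam < μ → ∀ x : Rd d, ⟪x, e⟫ < μ → 0 ≤ u x - u (reflAt e μ x)})
    :
    lamStar = lam₀ := by
  obtain ⟨L, hL⟩ := hf
  have hu : Continuous u := continuous_iff_lower_upperSemicontinuous.2 ⟨hsol.2.1, hsol.1.1⟩
  have hGne : (⋃ k, G k).Nonempty :=
    (hGconn ⟨0, hn⟩).nonempty.mono (subset_iUnion G ⟨0, hn⟩)
  have hno : ∀ ν > lam₀, ¬Sit1 (⋃ k, G k) e ν ∧ ¬Sit2 (⋃ k, G k) e ν := fun ν hν =>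
    not_or.1 fun h => not_le.2 hν (hlam₀.2 h)
  rw [hlamStar]
  refine IsLeast.csInf_eq ⟨⟨le_rfl, fun μ hμ x hx => ?_⟩, fun lam hlam => hlam.1⟩
  exact antisymm_nonneg_of_critical_lt hd S (isCompact_iUnion hGc)
    (HasC2BoundaryClosed.iUnion hGc hGC2 hGdisj) hGne hL hf₀.1 hmono hu hsol hA hG hbound hdecay
    he hno hμ hx
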